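/- Let n ≥ 1. There is a constant C depending only on n such that the following holds. Let Q ⊂ ℝ^{n+1} be a parabolic cube and let ν be a finite signed Borel measure supported in ℝ^{n+1} \ 4Q such that (i) for every parabolic cube R and every C² function φ admissible for R one has |∫ φ dν| ≤ ℓ(R)^{n+1}, (ii) ‖∇_x W * ν‖_∞ ≤ 1, and (iii) ‖W * ν‖_{Lip_{1/2,t}} ≤ 1. Then ∫_Q |∂_t^{1/2}(W * ν) − m_Q(∂_t^{1/2}(W * ν))| dm ≤ C ℓ(Q)^{n+2}, where m_Q denotes the mean over Q with respect to Lebesgue measure m. -/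

import Mathlib

open MeasureTheory Real Set

noncomputable section

/-- The spatial factor `ℝⁿ`. -/
abbrev Spc (n : ℕ) := EuclideanSpace ℝ (Fin n)

/-- The parabolic space `ℝ^{n+1} = ℝⁿ × ℝ`, points `x̄ = (x, t)`. -/
abbrev Pt (n : ℕ) := Spc n × ℝ

/-- The parabolic norm `|x̄|_p = max (|x|, |t|^{1/2})`. -/
def pnorm {n : ℕ} (p : Pt n) : ℝ := max ‖p.1‖ (Real.sqrt |p.2|)

/-- The parabolic ball of center `c` and radius `r`. -/
def pball {n : ℕ} (c : Pt n) (r : ℝ) : Set (Pt n) := {p | pnorm (p - c) < r}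

/-- The heat kernel `W`. -/
def heatW {n : ℕ} (p : Pt n) : ℝ :=
  if 0 < p.2 then (4 * π * p.2) ^ (-(n : ℝ) / 2) * Real.exp (-‖p.1‖ ^ 2 / (4 * p.2)) else 0

/-- The spatial gradient `∇ₓ W` of the heat kernel. -/
def gradW {n : ℕ} (p : Pt n) : Spc n :=
  if 0 < p.2 then
    (-(1 / (2 * p.2)) * (4 * π * p.2) ^ (-(n : ℝ) / 2) * Real.exp (-‖p.1‖ ^ 2 / (4 * p.2))) • p.1
  else 0

/-- Half time derivative `∂_t^{1/2} f (x,t) = ∫ (f(x,s) - f(x,t))/|s-t|^{3/2} ds`. -/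
def halfT {n : ℕ} (f : Pt n → ℝ) (p : Pt n) : ℝ :=
  ∫ s : ℝ, (f (p.1, s) - f p) / |s - p.2| ^ (3 / 2 : ℝ)

/-- A parabolic cube: product of `n` intervals of length `len` and a time interval
of length `len ^ 2`. -/
structure PCube (n : ℕ) where
  corner : Fin n → ℝ
  time : ℝ
  len : ℝ
  len_pos : 0 < len

/-- The set of points of a parabolic cube. -/
def PCube.toSet {n : ℕ} (Q : PCube n) : Set (Pt n) :=
  {p | (∀ i, p.1 i ∈ Set.Icc (Q.corner i) (Q.corner i + Q.len)) ∧
    p.2 ∈ Set.Icc Q.time (Q.time + Q.len ^ 2)}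

/-- The dilation `λQ` of a parabolic cube: same center, side lengths `λ·len` and
`λ²·len²`. -/
def PCube.dilate {n : ℕ} (Q : PCube n) (lam : ℝ) (h : 0 < lam) : PCube n :=
  ⟨fun i => Q.corner i + Q.len / 2 - lam * Q.len / 2,
    Q.time + Q.len ^ 2 / 2 - lam ^ 2 * Q.len ^ 2 / 2,
    lam * Q.len, mul_pos h Q.len_pos⟩

/-- Second directional derivative in the `i`-th spatial direction. -/
def dir2 {n : ℕ} (φ : Pt n → ℝ) (p : Pt n) (i : Fin n) : ℝ :=
  deriv (fun h : ℝ =>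
    deriv (fun h' : ℝ => φ (p.1 + h' • (EuclideanSpace.single i 1 : Spc n), p.2)) h) 0

/-- Spatial Laplacian `Δₓ φ`. -/
def lapx {n : ℕ} (φ : Pt n → ℝ) (p : Pt n) : ℝ := ∑ i : Fin n, dir2 φ p i

/-- A `C²` function `φ` is admissible for a parabolic cube `Q` if it is supported on `Q`,
`‖∇ₓ φ‖_∞ ≤ 1/ℓ(Q)` and `‖Δₓ φ‖_∞ + ‖∂_t φ‖_∞ ≤ 1/ℓ(Q)²`. -/
def Admissible {n : ℕ} (φ : Pt n → ℝ) (Q : PCube n) : Prop :=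
  ContDiff ℝ 2 φ ∧ tsupport φ ⊆ Q.toSet ∧
  (∀ p : Pt n, ‖fderiv ℝ (fun y : Spc n => φ (y, p.2)) p.1‖ ≤ 1 / Q.len) ∧
  (∀ p : Pt n, |lapx φ p| + |deriv (fun s : ℝ => φ (p.1, s)) p.2| ≤ 1 / Q.len ^ 2)

/-- The parabolic BMO norm of `f` is at most `C`. -/
def ParabBMOLe {n : ℕ} (f : Pt n → ℝ) (C : ℝ) : Prop :=
  ∀ Q : PCube n, ⨍ p in Q.toSet, |f p - ⨍ q in Q.toSet, f q| ≤ C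

/-- `‖F‖_{Lip_{1/2,t}} ≤ C` : half-Lipschitz in time. -/
def LipHalfLe {n : ℕ} (F : Pt n → ℝ) (C : ℝ) : Prop :=
  ∀ (x : Spc n) (t u : ℝ), |F (x, t) - F (x, u)| ≤ C * Real.sqrt |t - u|

/-- Integral of a scalar function against a finite signed measure. -/
def sInt {n : ℕ} (ν : SignedMeasure (Pt n)) (f : Pt n → ℝ) : ℝ :=
  ∫ y, f y ∂ν.toJordanDecomposition.posPart - ∫ y, f y ∂ν.toJordanDecomposition.negPart

/-- Integral of a vector-valued function against a finite signed measure. -/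
def vInt {n : ℕ} (ν : SignedMeasure (Pt n)) (f : Pt n → Spc n) : Spc n :=
  ∫ y, f y ∂ν.toJordanDecomposition.posPart - ∫ y, f y ∂ν.toJordanDecomposition.negPart

/-- `W * ν`. -/
def convW {n : ℕ} (ν : SignedMeasure (Pt n)) (p : Pt n) : ℝ :=
  sInt ν (fun y => heatW (p - y))

/-- `∇ₓ W * ν`. -/
def convGradW {n : ℕ} (ν : SignedMeasure (Pt n)) (p : Pt n) : Spc n :=
  vInt ν (fun y => gradW (p - y))

/-- `W * (φ ν)`, where `φν` is the measure with density `φ` w.r.t. `ν`. -/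
def convWd {n : ℕ} (ν : SignedMeasure (Pt n)) (φ : Pt n → ℝ) (p : Pt n) : ℝ :=
  sInt ν (fun y => φ y * heatW (p - y))

/-- `∇ₓ W * (φ ν)`. -/
def convGradWd {n : ℕ} (ν : SignedMeasure (Pt n)) (φ : Pt n → ℝ) (p : Pt n) : Spc n :=
  vInt ν (fun y => φ y • gradW (p - y))

/-- `W * μ` for a positive measure `μ`. -/
def mconvW {n : ℕ} (μ : Measure (Pt n)) (p : Pt n) : ℝ := ∫ y, heatW (p - y) ∂μ

/-- `∇ₓ W * μ` for a positive measure `μ`. -/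
def mconvGradW {n : ℕ} (μ : Measure (Pt n)) (p : Pt n) : Spc n := ∫ y, gradW (p - y) ∂μ

/-- Upper parabolic growth of degree `n+1` with constant `1`. -/
def PGrowth {n : ℕ} (μ : Measure (Pt n)) : Prop :=
  ∀ (c : Pt n) (r : ℝ), 0 < r → μ (pball c r) ≤ ENNReal.ofReal (r ^ (n + 1))

section helpers

variable {n : ℕ}


lemma heatW_nonneg (p : Pt n) : 0 ≤ heatW p := by
  unfold heatW
  split_ifs with h
  · positivity
  · exact le_rfl

lemma heatW_pos_eq (z : Spc n) {s : ℝ} (hs : 0 < s) :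
    heatW (z, s) = (4 * π * s) ^ (-(n : ℝ) / 2) * Real.exp (-‖z‖ ^ 2 / (4 * s)) := by
  simp [heatW, hs]

lemma heatW_neg_eq (z : Spc n) {s : ℝ} (hs : s ≤ 0) : heatW (z, s) = 0 := by
  simp [heatW, not_lt.mpr hs]

lemma heatW_even (z : Spc n) (s : ℝ) : heatW (-z, s) = heatW (z, s) := by
  simp [heatW]

lemma gradW_eq (z : Spc n) (s : ℝ) : gradW (z, s) = (-(1 / (2 * s)) * heatW (z, s)) • z := by
  unfold gradW heatW
  split_ifs with h
  · simp only [mul_assoc]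
  · simp

lemma norm_gradW (z : Spc n) {s : ℝ} (hs : 0 < s) :
    ‖gradW (z, s)‖ = 1 / (2 * s) * heatW (z, s) * ‖z‖ := by
  rw [gradW_eq, norm_smul, Real.norm_eq_abs, abs_mul, abs_neg, abs_of_nonneg (heatW_nonneg _),
    abs_of_pos (by positivity)]

lemma measurable_heatW : Measurable (heatW : Pt n → ℝ) := by
  unfold heatW
  refine Measurable.ite (measurableSet_lt measurable_const measurable_snd) ?_ measurable_const
  fun_prop

lemma measurable_gradW : Measurable (gradW : Pt n → Spc n) := by
  have : (gradW : Pt n → Spc n) = fun p => (-(1 / (2 * p.2)) * heatW p) • p.1 := by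
    ext1 p
    exact gradW_eq p.1 p.2
  rw [this]
  have := measurable_heatW (n := n)
  fun_prop

lemma heatW_scale (z : Spc n) {s : ℝ} (hs : 0 < s) :
    √s ^ n * heatW (√s • z, s) = heatW (z, 1) := by
  rw [heatW_pos_eq _ hs, heatW_pos_eq _ one_pos]
  have h1 : √s ^ n = s ^ ((n : ℝ) / 2) := by
    rw [Real.sqrt_eq_rpow, ← Real.rpow_natCast, ← Real.rpow_mul hs.le]
    ring_nf
  have h2 : (4 * π * s) ^ (-(n : ℝ) / 2) = (4 * π) ^ (-(n : ℝ) / 2) * s ^ (-(n : ℝ) / 2) :=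
    Real.mul_rpow (by positivity) hs.le
  have h3 : s ^ ((n : ℝ) / 2) * s ^ (-(n : ℝ) / 2) = 1 := by
    rw [← Real.rpow_add hs]; ring_nf; simp
  have h4 : -‖√s • z‖ ^ 2 / (4 * s) = -‖z‖ ^ 2 / (4 * 1) := by
    rw [norm_smul, mul_pow, Real.norm_eq_abs, abs_of_nonneg (Real.sqrt_nonneg _), Real.sq_sqrt hs.le]
    field_simp
  rw [h1, h2, h4]
  calc s ^ ((n : ℝ) / 2) * ((4 * π) ^ (-(n : ℝ) / 2) * s ^ (-(n : ℝ) / 2) * rexp (-‖z‖ ^ 2 / (4 * 1)))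
      = (s ^ ((n : ℝ) / 2) * s ^ (-(n : ℝ) / 2)) * ((4 * π) ^ (-(n : ℝ) / 2) * rexp (-‖z‖ ^ 2 / (4 * 1))) := by ring
    _ = _ := by rw [h3]; simp

/-- affine change of variables, lintegral version -/
lemma lint_affine (m : Spc n) {r : ℝ} (hr : 0 < r) {F : Spc n → ENNReal} (hF : Measurable F) :
    ∫⁻ z, F z = ENNReal.ofReal (r ^ n) * ∫⁻ z, F (m + r • z) := by
  have h1 : ∫⁻ z, F z = ∫⁻ z, F (m + z) := (lintegral_add_left_eq_self F m).symm
  have h2 : ∫⁻ z, F (m + r • z) = ∫⁻ z, F (m + z) ∂(Measure.map (fun x => r • x) volume) := by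
    rw [lintegral_map (by fun_prop) (by fun_prop)]
  rw [h2, Measure.map_addHaar_smul _ hr.ne', lintegral_smul_measure, h1]
  rw [smul_eq_mul, ← mul_assoc, ← ENNReal.ofReal_mul (by positivity)]
  have : r ^ n * |(r ^ Module.finrank ℝ (Spc n))⁻¹| = 1 := by
    rw [finrank_euclideanSpace, Fintype.card_fin, abs_of_pos (by positivity)]
    field_simp
  rw [this]; simp

lemma lint_heat (m : Spc n) {s : ℝ} (hs : 0 < s) {F : Spc n → ENNReal} (hF : Measurable F) :
    ∫⁻ z, ENNReal.ofReal (heatW (z - m, s)) * F z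
      = ∫⁻ z, ENNReal.ofReal (heatW (z, 1)) * F (m + √s • z) := by
  have hW := measurable_heatW (n := n)
  rw [lint_affine m (Real.sqrt_pos.mpr hs) (by fun_prop), ← lintegral_const_mul _ (by fun_prop)]
  congr 1 with z
  rw [← mul_assoc, ← ENNReal.ofReal_mul (by positivity), add_sub_cancel_left, heatW_scale _ hs]

lemma int_heat {E : Type*} [NormedAddCommGroup E] [NormedSpace ℝ E] (m : Spc n) {s : ℝ} (hs : 0 < s)
    (F : Spc n → E) :
    ∫ z, heatW (z - m, s) • F z = ∫ z, heatW (z, 1) • F (m + √s • z) := by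
  have hr := Real.sqrt_pos.mpr hs
  have h1 := integral_add_left_eq_self (μ := (volume : Measure (Spc n)))
    (fun z => heatW (z - m, s) • F z) m
  have h2 := Measure.integral_comp_smul (volume : Measure (Spc n))
    (fun z => heatW (m + z - m, s) • F (m + z)) (√s)
  simp only [add_sub_cancel_left] at h1 h2
  rw [← h1]
  have : (∫ z, heatW (z, 1) • F (m + √s • z)) = (√s) ^ n • ∫ z, heatW (√s • z, s) • F (m + √s • z) := by
    rw [← integral_smul]
    congr 1 with z
    rw [smul_smul, heatW_scale _ hs]
  rw [this, h2, finrank_euclideanSpace, Fintype.card_fin, smul_smul, abs_of_pos (by positivity)]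
  rw [mul_inv_cancel₀ (by positivity), one_smul]

lemma integrable_gauss {b : ℝ} (hb : 0 < b) : Integrable (fun z : Spc n => Real.exp (-b * ‖z‖ ^ 2)) := by
  have h := GaussianFourier.integral_rexp_neg_mul_sq_norm (V := Spc n) hb
  by_contra hc
  rw [integral_undef hc] at h
  have : 0 < (π / b) ^ ((Module.finrank ℝ (Spc n) : ℝ) / 2) := by positivity
  linarith

lemma integrable_heat1 : Integrable (fun z : Spc n => heatW (z, 1)) := by
  have := (integrable_gauss (n := n) (b := 1/4) (by norm_num)).const_mul ((4 * π * 1) ^ (-(n : ℝ) / 2))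
  refine this.congr (Filter.Eventually.of_forall fun z => ?_)
  simp only [heatW_pos_eq _ one_pos]
  congr 2; ring

lemma integral_heat1 : ∫ z : Spc n, heatW (z, 1) = 1 := by
  have h := GaussianFourier.integral_rexp_neg_mul_sq_norm (V := Spc n) (b := 1/4) (by norm_num)
  have : ∀ z : Spc n, heatW (z, 1) = (4 * π) ^ (-(n : ℝ) / 2) * Real.exp (-(1/4) * ‖z‖ ^ 2) := by
    intro z
    rw [heatW_pos_eq _ one_pos]
    congr 2 <;> ring
  simp_rw [this]
  rw [integral_const_mul, h, finrank_euclideanSpace, Fintype.card_fin]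
  have : π / (1/4) = 4 * π := by ring
  rw [this, ← Real.rpow_add (by positivity)]
  ring_nf; simp

lemma integrable_heat1_sq : Integrable (fun z : Spc n => heatW (z, 1) * ‖z‖ ^ 2) := by
  have h := (integrable_gauss (n := n) (b := 1/8) (by norm_num)).const_mul ((4 * π * 1) ^ (-(n : ℝ) / 2) * 8)
  have hW := measurable_heatW (n := n)
  refine h.mono' (by fun_prop) (Filter.Eventually.of_forall fun z => ?_)
  rw [Real.norm_of_nonneg (mul_nonneg (heatW_nonneg _) (by positivity)), heatW_pos_eq _ one_pos]
  have h1 : ‖z‖ ^ 2 ≤ 8 * Real.exp (1/8 * ‖z‖ ^ 2) := by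
    have := Real.add_one_le_exp (1/8 * ‖z‖ ^ 2)
    linarith
  have h2 : Real.exp (-‖z‖ ^ 2 / (4 * 1)) * Real.exp (1/8 * ‖z‖ ^ 2) = Real.exp (-(1/8) * ‖z‖ ^ 2) := by
    rw [← Real.exp_add]; congr 1; ring
  have hc : 0 ≤ (4 * π * 1) ^ (-(n : ℝ) / 2) := by positivity
  rw [← h2]
  calc _ ≤ (4 * π * 1) ^ (-(n : ℝ) / 2) * rexp (-‖z‖ ^ 2 / (4 * 1)) * (8 * Real.exp (1/8 * ‖z‖ ^ 2)) := by gcongr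
    _ = _ := by ring

lemma integrable_heat1_norm : Integrable (fun z : Spc n => heatW (z, 1) * ‖z‖) := by
  have hW := measurable_heatW (n := n)
  refine (integrable_heat1.add integrable_heat1_sq).mono' (by fun_prop)
    (Filter.Eventually.of_forall fun z => ?_)
  rw [Real.norm_of_nonneg (mul_nonneg (heatW_nonneg _) (by positivity))]
  simp only [Pi.add_apply]
  have := heatW_nonneg (z, (1:ℝ))
  nlinarith [sq_nonneg (‖z‖ - 1)]

/-- first absolute moment -/
def M1 (n : ℕ) : ℝ := ∫ z : Spc n, heatW (z, 1) * ‖z‖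
/-- second moment -/
def M2 (n : ℕ) : ℝ := ∫ z : Spc n, heatW (z, 1) * ‖z‖ ^ 2

lemma M1_nonneg : 0 ≤ M1 n := integral_nonneg fun _ => mul_nonneg (heatW_nonneg _) (norm_nonneg _)
lemma M2_nonneg : 0 ≤ M2 n := integral_nonneg fun _ => mul_nonneg (heatW_nonneg _) (by positivity)

lemma lint_heat1 : ∫⁻ z : Spc n, ENNReal.ofReal (heatW (z, 1)) = 1 := by
  rw [← ofReal_integral_eq_lintegral_ofReal integrable_heat1
    (Filter.Eventually.of_forall fun z => heatW_nonneg _), integral_heat1]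
  simp
lemma lint_heat1_norm : ∫⁻ z : Spc n, ENNReal.ofReal (heatW (z, 1) * ‖z‖) = ENNReal.ofReal (M1 n) := by
  rw [← ofReal_integral_eq_lintegral_ofReal integrable_heat1_norm
    (Filter.Eventually.of_forall fun z => mul_nonneg (heatW_nonneg _) (norm_nonneg _)), M1]
lemma lint_heat1_sq : ∫⁻ z : Spc n, ENNReal.ofReal (heatW (z, 1) * ‖z‖ ^ 2) = ENNReal.ofReal (M2 n) := by
  rw [← ofReal_integral_eq_lintegral_ofReal integrable_heat1_sq
    (Filter.Eventually.of_forall fun z => mul_nonneg (heatW_nonneg _) (sq_nonneg _)), M2]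

/-- product formula (Brownian bridge) -/
lemma heat_prod (x y z : Spc n) {α β : ℝ} (ha : 0 < α) (hb : 0 < β) :
    heatW (x - z, α) * heatW (z - y, β) =
      heatW (x - y, α + β) * heatW (z - (y + (β / (α + β)) • (x - y)), α * β / (α + β)) := by
  have hab : 0 < α + β := by positivity
  rw [heatW_pos_eq _ ha, heatW_pos_eq _ hb, heatW_pos_eq _ hab, heatW_pos_eq _ (by positivity)]
  have h1 : (4 * π * α) ^ (-(n : ℝ) / 2) * (4 * π * β) ^ (-(n : ℝ) / 2) =
      (4 * π * (α + β)) ^ (-(n : ℝ) / 2) * (4 * π * (α * β / (α + β))) ^ (-(n : ℝ) / 2) := by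
    rw [← Real.mul_rpow (by positivity) (by positivity), ← Real.mul_rpow (by positivity) (by positivity)]
    congr 1
    field_simp
  have h2 : -‖x - z‖ ^ 2 / (4 * α) + -‖z - y‖ ^ 2 / (4 * β) =
      -‖x - y‖ ^ 2 / (4 * (α + β)) +
        -‖z - (y + (β / (α + β)) • (x - y))‖ ^ 2 / (4 * (α * β / (α + β))) := by
    have e1 : x - z = (x - y) - (z - y) := by abel
    have e2 : z - (y + (β / (α + β)) • (x - y)) = (z - y) - (β / (α + β)) • (x - y) := by abel
    rw [e1, e2]
    generalize x - y = a
    generalize z - y = b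
    rw [norm_sub_sq_real, norm_sub_sq_real, norm_smul, mul_pow, real_inner_smul_right, Real.norm_eq_abs,
      sq_abs, real_inner_comm b a]
    field_simp
    ring
  calc _ = ((4 * π * α) ^ (-(n : ℝ) / 2) * (4 * π * β) ^ (-(n : ℝ) / 2)) *
        Real.exp (-‖x - z‖ ^ 2 / (4 * α) + -‖z - y‖ ^ 2 / (4 * β)) := by rw [Real.exp_add]; ring
    _ = _ := by rw [h1, h2, Real.exp_add]; ring



lemma heatW_sub_comm (x z : Spc n) (s : ℝ) : heatW (x - z, s) = heatW (z - x, s) := by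
  rw [← heatW_even, neg_sub]

lemma norm_gradW_sub_comm (x z : Spc n) (s : ℝ) : ‖gradW (x - z, s)‖ = ‖gradW (z - x, s)‖ := by
  rw [gradW_eq, gradW_eq, heatW_sub_comm, norm_smul, norm_smul, norm_sub_rev]

lemma lint_W (x : Spc n) {s : ℝ} (hs : 0 < s) : ∫⁻ z, ENNReal.ofReal (heatW (x - z, s)) = 1 := by
  have := lint_heat x hs (F := fun _ => 1) measurable_const
  simp only [mul_one] at this
  simp_rw [heatW_sub_comm x]
  rw [this, lint_heat1]

lemma lint_gradW (x : Spc n) {s : ℝ} (hs : 0 < s) :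
    ∫⁻ z, ENNReal.ofReal ‖gradW (x - z, s)‖ = ENNReal.ofReal (M1 n / (2 * √s)) := by
  have h := lint_heat x hs (F := fun z => ENNReal.ofReal (1 / (2 * s) * ‖z - x‖)) (by fun_prop)
  have e1 : ∀ z, ENNReal.ofReal ‖gradW (x - z, s)‖ =
      ENNReal.ofReal (heatW (z - x, s)) * ENNReal.ofReal (1 / (2 * s) * ‖z - x‖) := by
    intro z
    rw [norm_gradW _ hs, ← ENNReal.ofReal_mul (heatW_nonneg _), heatW_sub_comm, norm_sub_rev]
    ring_nf
  simp_rw [e1]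
  rw [h]
  have hr := Real.sqrt_pos.mpr hs
  have e2 : ∀ z : Spc n, ENNReal.ofReal (heatW (z, 1)) * ENNReal.ofReal (1 / (2 * s) * ‖x + √s • z - x‖)
      = ENNReal.ofReal (1 / (2 * √s)) * ENNReal.ofReal (heatW (z, 1) * ‖z‖) := by
    intro z
    rw [← ENNReal.ofReal_mul (heatW_nonneg _), ← ENNReal.ofReal_mul (by positivity),
      add_sub_cancel_left, norm_smul, Real.norm_of_nonneg hr.le]
    congr 1
    have : s = √s * √s := (Real.mul_self_sqrt hs.le).symm
    field_simp
    rw [sq, Real.mul_self_sqrt hs.le]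
  simp_rw [e2]
  have hW := measurable_heatW (n := n)
  rw [lintegral_const_mul _ (by fun_prop), lint_heat1_norm, ← ENNReal.ofReal_mul (by positivity)]
  congr 1; ring

lemma lint_k2 (x : Spc n) {s : ℝ} (hs : 0 < s) :
    ∫⁻ z, ENNReal.ofReal (‖x - z‖ * ‖gradW (x - z, s)‖) = ENNReal.ofReal (M2 n / 2) := by
  have h := lint_heat x hs (F := fun z => ENNReal.ofReal (1 / (2 * s) * ‖z - x‖ ^ 2)) (by fun_prop)
  have e1 : ∀ z, ENNReal.ofReal (‖x - z‖ * ‖gradW (x - z, s)‖) =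
      ENNReal.ofReal (heatW (z - x, s)) * ENNReal.ofReal (1 / (2 * s) * ‖z - x‖ ^ 2) := by
    intro z
    rw [norm_gradW _ hs, ← ENNReal.ofReal_mul (heatW_nonneg _), heatW_sub_comm, norm_sub_rev]
    ring_nf
  simp_rw [e1]
  rw [h]
  have hr := Real.sqrt_pos.mpr hs
  have e2 : ∀ z : Spc n, ENNReal.ofReal (heatW (z, 1)) * ENNReal.ofReal (1 / (2 * s) * ‖x + √s • z - x‖ ^ 2)
      = ENNReal.ofReal (1 / 2) * ENNReal.ofReal (heatW (z, 1) * ‖z‖ ^ 2) := by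
    intro z
    rw [← ENNReal.ofReal_mul (heatW_nonneg _), ← ENNReal.ofReal_mul (by positivity),
      add_sub_cancel_left, norm_smul, Real.norm_of_nonneg hr.le, mul_pow, Real.sq_sqrt hs.le]
    congr 1
    field_simp
  simp_rw [e2]
  have hW := measurable_heatW (n := n)
  rw [lintegral_const_mul _ (by fun_prop), lint_heat1_sq, ← ENNReal.ofReal_mul (by positivity)]
  congr 1; ring

lemma kb0 (x y : Spc n) {α β : ℝ} (ha : 0 < α) (hb : 0 < β) :
    ∫⁻ z, ENNReal.ofReal (heatW (x - z, α) * heatW (z - y, β)) =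
      ENNReal.ofReal (heatW (x - y, α + β)) := by
  have hW := measurable_heatW (n := n)
  simp_rw [heat_prod x y _ ha hb, ENNReal.ofReal_mul (heatW_nonneg _)]
  rw [lintegral_const_mul _ (by fun_prop)]
  simp_rw [heatW_sub_comm _ (y + _)]
  rw [lint_W _ (by positivity), mul_one]

lemma kb1 (x y : Spc n) {α β : ℝ} (ha : 0 < α) (hb : 0 < β) :
    ∫⁻ z, ENNReal.ofReal (heatW (x - z, α) * ‖gradW (z - y, β)‖) ≤
      ENNReal.ofReal (‖gradW (x - y, α + β)‖ + heatW (x - y, α + β) * (M1 n / (2 * √β))) := by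
  have hW := measurable_heatW (n := n)
  have hG := measurable_gradW (n := n)
  have hab : 0 < α + β := by positivity
  set m := y + (β / (α + β)) • (x - y) with hm
  set s := α * β / (α + β) with hs
  have hspos : 0 < s := by positivity
  have hsb : s ≤ β := by rw [hs, div_le_iff₀ hab]; nlinarith
  have e1 : ∀ z, ENNReal.ofReal (heatW (x - z, α) * ‖gradW (z - y, β)‖) =
      ENNReal.ofReal (heatW (x - y, α + β)) * (ENNReal.ofReal (heatW (z - m, s)) *
        ENNReal.ofReal (1 / (2 * β) * ‖z - y‖)) := by
    intro z
    rw [← ENNReal.ofReal_mul (heatW_nonneg _), ← ENNReal.ofReal_mul (heatW_nonneg _), ← mul_assoc,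
      ← heat_prod x y z ha hb, norm_gradW _ hb]
    ring_nf
  simp_rw [e1]
  rw [lintegral_const_mul _ (by fun_prop), lint_heat m hspos (by fun_prop)]
  have e2 : ∀ z, ENNReal.ofReal (heatW (z, 1)) * ENNReal.ofReal (1 / (2 * β) * ‖m + √s • z - y‖) ≤
      ENNReal.ofReal (1 / (2 * (α + β)) * ‖x - y‖) * ENNReal.ofReal (heatW (z, 1)) +
      ENNReal.ofReal (1 / (2 * √β)) * ENNReal.ofReal (heatW (z, 1) * ‖z‖) := by
    intro z
    have hw := heatW_nonneg (z, (1:ℝ))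
    rw [← ENNReal.ofReal_mul (heatW_nonneg _), ← ENNReal.ofReal_mul (by positivity),
      ← ENNReal.ofReal_mul (by positivity), ← ENNReal.ofReal_add (by positivity) (by positivity)]
    apply ENNReal.ofReal_le_ofReal
    have h1 : ‖m + √s • z - y‖ ≤ β / (α + β) * ‖x - y‖ + √β * ‖z‖ := by
      have : m + √s • z - y = (β / (α + β)) • (x - y) + √s • z := by rw [hm]; abel
      rw [this]
      refine (norm_add_le _ _).trans ?_
      rw [norm_smul, norm_smul, Real.norm_of_nonneg (by positivity : 0 ≤ β / (α + β)),
        Real.norm_of_nonneg (Real.sqrt_nonneg _)]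
      have := Real.sqrt_le_sqrt hsb
      gcongr
    have hb' := Real.sqrt_pos.mpr hb
    calc heatW (z, 1) * (1 / (2 * β) * ‖m + √s • z - y‖)
        ≤ heatW (z, 1) * (1 / (2 * β) * (β / (α + β) * ‖x - y‖ + √β * ‖z‖)) := by gcongr
      _ = _ := by
        have h3 : √β / β = 1 / √β := by
          rw [div_eq_div_iff hb.ne' hb'.ne', Real.mul_self_sqrt hb.le]; ring
        have h4 : 1 / (2 * β) * √β = 1 / (2 * √β) := by
          calc _ = (√β / β) / 2 := by field_simp
            _ = _ := by rw [h3]; field_simp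
        rw [← h4]
        field_simp
  refine (mul_le_mul_right (lintegral_mono e2) _).trans ?_
  rw [lintegral_add_left (by fun_prop), lintegral_const_mul _ (by fun_prop),
    lintegral_const_mul _ (by fun_prop), lint_heat1, lint_heat1_norm, norm_gradW _ hab]
  have h0 := heatW_nonneg (x - y, α + β)
  have h1 := M1_nonneg (n := n)
  rw [mul_one, ← ENNReal.ofReal_mul (by positivity), ← ENNReal.ofReal_add (by positivity) (by positivity),
    ← ENNReal.ofReal_mul (by positivity)]
  apply le_of_eq
  congr 1; ring

lemma kb2 (x y : Spc n) {α β : ℝ} (ha : 0 < α) (hb : 0 < β) :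
    ∫⁻ z, ENNReal.ofReal (‖gradW (x - z, α)‖ * heatW (z - y, β)) ≤
      ENNReal.ofReal (‖gradW (x - y, α + β)‖ + heatW (x - y, α + β) * (M1 n / (2 * √α))) := by
  have := kb1 y x hb ha
  rw [norm_gradW_sub_comm y x, heatW_sub_comm y x, add_comm β α] at this
  refine le_trans (le_of_eq ?_) this
  congr 1 with z
  rw [norm_gradW_sub_comm x z, heatW_sub_comm z y, mul_comm]



lemma heatW_le_one (z : Spc n) {s : ℝ} (hs : 1 ≤ s) : heatW (z, s) ≤ 1 := by
  rw [heatW_pos_eq _ (by linarith)]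
  have h1 : (4 * π * s) ^ (-(n : ℝ) / 2) ≤ 1 := by
    apply Real.rpow_le_one_of_one_le_of_nonpos
    · nlinarith [Real.pi_gt_three]
    · have : (0:ℝ) ≤ n := Nat.cast_nonneg n
      linarith
  have h2 : rexp (-‖z‖ ^ 2 / (4 * s)) ≤ 1 := by
    apply Real.exp_le_one_iff.mpr
    apply div_nonpos_of_nonpos_of_nonneg <;> nlinarith [sq_nonneg ‖z‖]
  have h3 : 0 ≤ rexp (-‖z‖ ^ 2 / (4 * s)) := (Real.exp_pos _).le
  exact mul_le_one₀ h1 h3 h2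

instance instHaarPt : (volume : Measure (Pt n)).IsAddHaarMeasure := by
  rw [Measure.volume_eq_prod]; infer_instance

lemma norm_gradW_le_one (z : Spc n) {s : ℝ} (hs : 1 ≤ s) : ‖gradW (z, s)‖ ≤ 1 := by
  have hs0 : 0 < s := by linarith
  rw [norm_gradW _ hs0, heatW_pos_eq _ hs0]
  have h1 : (4 * π * s) ^ (-(n : ℝ) / 2) ≤ 1 := by
    apply Real.rpow_le_one_of_one_le_of_nonpos
    · nlinarith [Real.pi_gt_three]
    · have : (0:ℝ) ≤ n := Nat.cast_nonneg n
      linarith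
  have h2 : ‖z‖ / (2 * s) ≤ rexp (‖z‖ ^ 2 / (4 * s)) := by
    have := Real.add_one_le_exp (‖z‖ ^ 2 / (4 * s))
    have h4 : ‖z‖ / (2 * s) ≤ ‖z‖ ^ 2 / (4 * s) + 1 := by
      have : ‖z‖ ^ 2 / (4 * s) + 1 - ‖z‖ / (2 * s) = (‖z‖ ^ 2 + 4 * s - 2 * ‖z‖) / (4 * s) := by
        field_simp
        ring
      have h5 : 0 ≤ (‖z‖ ^ 2 + 4 * s - 2 * ‖z‖) / (4 * s) := by
        apply div_nonneg <;> nlinarith [sq_nonneg (‖z‖ - 1)]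
      linarith
    linarith
  have h3 : rexp (-‖z‖ ^ 2 / (4 * s)) = (rexp (‖z‖ ^ 2 / (4 * s)))⁻¹ := by
    rw [← Real.exp_neg]; congr 1; ring
  have hE := Real.exp_pos (‖z‖ ^ 2 / (4 * s))
  calc _ = (4 * π * s) ^ (-(n : ℝ) / 2) * (‖z‖ / (2 * s) * rexp (-‖z‖ ^ 2 / (4 * s))) := by ring
    _ ≤ 1 * 1 := by
      gcongr
      rw [h3, ← div_eq_mul_inv, div_le_one hE]
      exact h2
    _ = 1 := by ring

lemma lint_inv_sqrt : ∫⁻ τ in Ioo (0:ℝ) 1, ENNReal.ofReal (1 / √τ) < ⊤ := by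
  have h : IntervalIntegrable (fun x : ℝ => x ^ (-(1/2) : ℝ)) volume 0 1 :=
    intervalIntegral.intervalIntegrable_rpow' (by norm_num)
  have h2 : IntegrableOn (fun x : ℝ => x ^ (-(1/2) : ℝ)) (Ioo 0 1) :=
    ((intervalIntegrable_iff_integrableOn_Ioc_of_le zero_le_one).mp h).mono_set Ioo_subset_Ioc_self
  have h3 := h2.2
  unfold HasFiniteIntegral at h3
  refine lt_of_le_of_lt (le_of_eq ?_) h3
  apply setLIntegral_congr_fun measurableSet_Ioo
  intro x hx
  simp only
  rw [← ofReal_norm, Real.norm_of_nonneg (Real.rpow_nonneg hx.1.le _), Real.rpow_neg hx.1.le,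
    Real.sqrt_eq_rpow, one_div, one_div]

/-- sum kernel restricted to short times -/
def K1 (p : Pt n) : ENNReal :=
  if 0 < p.2 ∧ p.2 < 1 then ENNReal.ofReal (heatW p) + ENNReal.ofReal ‖gradW p‖ else 0

lemma measurable_K1 : Measurable (K1 : Pt n → ENNReal) := by
  have hW := measurable_heatW (n := n)
  have hG := measurable_gradW (n := n)
  unfold K1
  refine Measurable.ite ?_ (by fun_prop) measurable_const
  exact (measurableSet_lt measurable_const measurable_snd).inter
    (measurableSet_lt measurable_snd measurable_const)

lemma lint_K1 : ∫⁻ p : Pt n, K1 p < ⊤ := by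
  have hW := measurable_heatW (n := n)
  have hG := measurable_gradW (n := n)
  rw [Measure.volume_eq_prod, lintegral_prod_symm _ measurable_K1.aemeasurable]
  have : ∀ τ : ℝ, ∫⁻ z : Spc n, K1 (z, τ) =
      (Ioo (0:ℝ) 1).indicator (fun τ => 1 + ENNReal.ofReal (M1 n / 2) * ENNReal.ofReal (1 / √τ)) τ := by
    intro τ
    by_cases h : 0 < τ ∧ τ < 1
    · rw [indicator_of_mem (show τ ∈ Ioo (0:ℝ) 1 from h)]
      simp only [K1, h, and_self, if_true]
      rw [lintegral_add_left (by fun_prop)]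
      have h1 := lint_W (0 : Spc n) h.1
      have h2 := lint_gradW (0 : Spc n) h.1
      simp_rw [heatW_sub_comm 0, norm_gradW_sub_comm 0, sub_zero] at h1 h2
      rw [h1, h2, ← ENNReal.ofReal_mul (by have := M1_nonneg (n := n); positivity)]
      congr 2; field_simp
    · rw [indicator_of_notMem (show τ ∉ Ioo (0:ℝ) 1 from h)]
      simp [K1, h]
  simp_rw [this]
  rw [lintegral_indicator measurableSet_Ioo, lintegral_add_left measurable_const,
    lintegral_const_mul _ (by fun_prop)]
  refine ENNReal.add_lt_top.mpr ⟨by simp, ENNReal.mul_lt_top ENNReal.ofReal_lt_top lint_inv_sqrt⟩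

lemma le_K1 (p : Pt n) : ENNReal.ofReal (heatW p) + ENNReal.ofReal ‖gradW p‖ ≤ K1 p + 2 := by
  unfold K1
  split_ifs with h
  · exact le_self_add
  · rw [zero_add]
    obtain ⟨z, τ⟩ := p
    simp only [not_and, not_lt] at h
    by_cases h0 : 0 < τ
    · have h1 := h h0
      have a := ENNReal.ofReal_le_ofReal (heatW_le_one z h1)
      have b := ENNReal.ofReal_le_ofReal (norm_gradW_le_one z h1)
      rw [ENNReal.ofReal_one] at a b
      calc _ ≤ (1:ENNReal) + 1 := add_le_add a b
        _ = 2 := one_add_one_eq_two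
    · simp [gradW_eq, heatW_neg_eq z (not_lt.mp h0)]

lemma tonelli {Y : Type*} [MeasurableSpace Y] (μ : Measure Y) [IsFiniteMeasure μ] (a : Y → Pt n)
    (ha : Measurable a) : ∀ᵐ p : Pt n, Integrable (fun y => heatW (p - a y)) μ ∧
      Integrable (fun y => gradW (p - a y)) μ := by
  have hW := measurable_heatW (n := n)
  have hG := measurable_gradW (n := n)
  have hK := measurable_K1 (n := n)
  have hm : Measurable (fun q : Pt n × Y => K1 (q.1 - a q.2)) := by fun_prop
  have h1 : ∫⁻ p : Pt n, ∫⁻ y, K1 (p - a y) ∂μ < ⊤ := by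
    rw [lintegral_lintegral_swap hm.aemeasurable]
    simp_rw [lintegral_sub_right_eq_self (μ := (volume : Measure (Pt n))) K1]
    rw [lintegral_const]
    exact ENNReal.mul_lt_top lint_K1 (measure_lt_top _ _)
  have h2 := ae_lt_top (Measurable.lintegral_prod_right' hm) h1.ne
  filter_upwards [h2] with p hp
  have h3 : ∫⁻ y, (ENNReal.ofReal (heatW (p - a y)) + ENNReal.ofReal ‖gradW (p - a y)‖) ∂μ < ⊤ := by
    refine (lintegral_mono (fun y => le_K1 (p - a y))).trans_lt ?_
    rw [lintegral_add_right _ measurable_const]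
    refine ENNReal.add_lt_top.mpr ⟨hp, ?_⟩
    rw [lintegral_const]
    exact ENNReal.mul_lt_top (by simp) (measure_lt_top _ _)
  rw [lintegral_add_left (by fun_prop)] at h3
  have h4 := ENNReal.add_lt_top.mp h3
  have m1 : Measurable (fun y => heatW (p - a y)) := by fun_prop
  have m2 : Measurable (fun y => gradW (p - a y)) := by fun_prop
  refine ⟨⟨m1.aestronglyMeasurable, ?_⟩, ⟨m2.aestronglyMeasurable, ?_⟩⟩
  · refine lt_of_le_of_lt (le_of_eq ?_) h4.1
    congr 1 with y
    rw [← ofReal_norm, Real.norm_of_nonneg (heatW_nonneg _)]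
  · refine lt_of_le_of_lt (le_of_eq ?_) h4.2
    congr 1 with y
    rw [← ofReal_norm]

lemma l1_mono {k1 k2 : Spc n → ℝ} (h1 : Measurable k1) (h2 : Measurable k2) (p1 : ∀ z, 0 ≤ k1 z)
    {lam M : ℝ} (hl : 0 ≤ lam) (hl1 : lam ≤ 1) (hM : 0 ≤ M)
    (hle : ∀ z, lam * k1 z ≤ k2 z) (i1 : ∫⁻ z, ENNReal.ofReal (k1 z) = ENNReal.ofReal M)
    (i2 : ∫⁻ z, ENNReal.ofReal (k2 z) = ENNReal.ofReal M) :
    ∫⁻ z, ENNReal.ofReal |k2 z - k1 z| ≤ ENNReal.ofReal (2 * M * (1 - lam)) := by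
  have hA : ∫⁻ z, ENNReal.ofReal (k2 z - lam * k1 z) = ENNReal.ofReal (M * (1 - lam)) := by
    have e : ∀ z, ENNReal.ofReal (k2 z) =
        ENNReal.ofReal (k2 z - lam * k1 z) + ENNReal.ofReal lam * ENNReal.ofReal (k1 z) := by
      intro z
      rw [← ENNReal.ofReal_mul hl, ← ENNReal.ofReal_add (by linarith [hle z]) (mul_nonneg hl (p1 z))]
      congr 1; ring
    simp_rw [e] at i2
    rw [lintegral_add_left (by fun_prop), lintegral_const_mul _ (by fun_prop), i1,
      ← ENNReal.ofReal_mul hl] at i2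
    rw [ENNReal.eq_sub_of_add_eq ENNReal.ofReal_ne_top i2, ← ENNReal.ofReal_sub _ (by positivity)]
    congr 1; ring
  have hB : ∀ z, ENNReal.ofReal |k2 z - k1 z| ≤ ENNReal.ofReal (k2 z - lam * k1 z) +
      ENNReal.ofReal (1 - lam) * ENNReal.ofReal (k1 z) := by
    intro z
    have h3 : 0 ≤ (1 - lam) * k1 z := mul_nonneg (by linarith) (p1 z)
    rw [← ENNReal.ofReal_mul (by linarith), ← ENNReal.ofReal_add (by linarith [hle z]) h3]
    apply ENNReal.ofReal_le_ofReal
    rw [abs_le]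
    constructor <;> linarith [hle z]
  refine (lintegral_mono hB).trans ?_
  have h3 : 0 ≤ M * (1 - lam) := mul_nonneg hM (by linarith)
  rw [lintegral_add_left (by fun_prop), lintegral_const_mul _ (by fun_prop), hA, i1,
    ← ENNReal.ofReal_mul (by linarith), ← ENNReal.ofReal_add h3 (by linarith)]
  apply le_of_eq; congr 1; ring

lemma heatW_mono (v : Spc n) {a b : ℝ} (ha : 0 < a) (hab : a ≤ b) :
    (a / b) ^ n * heatW (v, a) ≤ heatW (v, b) := by
  have hb : 0 < b := by linarith
  rw [heatW_pos_eq _ ha, heatW_pos_eq _ hb]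
  have h1 : (a / b) ^ n ≤ (a / b) ^ ((n : ℝ) / 2) := by
    rw [← Real.rpow_natCast]
    apply Real.rpow_le_rpow_of_exponent_ge (by positivity) ((div_le_one hb).mpr hab)
    have : (0:ℝ) ≤ n := Nat.cast_nonneg n
    linarith
  have h2 : (a / b) ^ ((n : ℝ) / 2) * (4 * π * a) ^ (-(n : ℝ) / 2) = (4 * π * b) ^ (-(n : ℝ) / 2) := by
    rw [neg_div, Real.rpow_neg (by positivity), Real.rpow_neg (by positivity), ← Real.inv_rpow (by positivity),
      ← Real.inv_rpow (by positivity), ← Real.mul_rpow (by positivity) (by positivity)]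
    congr 1; field_simp
  have h3 : rexp (-‖v‖ ^ 2 / (4 * a)) ≤ rexp (-‖v‖ ^ 2 / (4 * b)) := by
    apply Real.exp_le_exp.mpr
    rw [neg_div, neg_div]
    apply neg_le_neg
    gcongr
  calc _ = ((a / b) ^ n * (4 * π * a) ^ (-(n : ℝ) / 2)) * rexp (-‖v‖ ^ 2 / (4 * a)) := by ring
    _ ≤ ((a / b) ^ ((n : ℝ) / 2) * (4 * π * a) ^ (-(n : ℝ) / 2)) * rexp (-‖v‖ ^ 2 / (4 * b)) := by gcongr
    _ = _ := by rw [h2]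

lemma grad_diff (v : Spc n) (a b : ℝ) :
    ‖v‖ * ‖gradW (v, b) - gradW (v, a)‖ =
      |1 / (2 * b) * heatW (v, b) * ‖v‖ ^ 2 - 1 / (2 * a) * heatW (v, a) * ‖v‖ ^ 2| := by
  rw [gradW_eq, gradW_eq, ← sub_smul, norm_smul, Real.norm_eq_abs]
  rw [← sub_mul, abs_mul, abs_of_nonneg (sq_nonneg ‖v‖), ← abs_neg]
  ring_nf

/-- The kernel time-difference bound. -/
lemma kernel_holder (x : Spc n) {a b : ℝ} (hab : a < b) (ha : a ≠ 0) :
    ∫⁻ z, ENNReal.ofReal (|heatW (x - z, b) - heatW (x - z, a)| +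
        ‖x - z‖ * ‖gradW (x - z, b) - gradW (x - z, a)‖) ≤
      ENNReal.ofReal ((2 + M2 n) * (n + 1) * ((b - a) / |a|) ^ (3 / 4 : ℝ)) := by
  have hW := measurable_heatW (n := n)
  have hG := measurable_gradW (n := n)
  have hM := M2_nonneg (n := n)
  have hn0 : (0:ℝ) ≤ n := Nat.cast_nonneg n
  have hh : 0 < b - a := by linarith
  have habs : 0 < |a| := abs_pos.mpr ha
  have split : ∫⁻ z, ENNReal.ofReal (|heatW (x - z, b) - heatW (x - z, a)| +
        ‖x - z‖ * ‖gradW (x - z, b) - gradW (x - z, a)‖) =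
      (∫⁻ z, ENNReal.ofReal (|heatW (x - z, b) - heatW (x - z, a)|)) +
      ∫⁻ z, ENNReal.ofReal (‖x - z‖ * ‖gradW (x - z, b) - gradW (x - z, a)‖) := by
    rw [← lintegral_add_left (by fun_prop)]
    congr 1 with z
    rw [ENNReal.ofReal_add (by positivity) (by positivity)]
  rw [split]
  rcases le_or_gt b 0 with hb | hb
  · have : ∀ z : Spc n, heatW (z, b) = 0 ∧ heatW (z, a) = 0 := fun z =>
      ⟨heatW_neg_eq z hb, heatW_neg_eq z (by linarith)⟩
    simp [gradW_eq, this]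
  rcases lt_or_gt_of_ne ha with ha | ha
  · have h0 : ∀ z : Spc n, heatW (z, a) = 0 := fun z => heatW_neg_eq z ha.le
    have h1 : ∀ z : Spc n, gradW (z, a) = 0 := fun z => by rw [gradW_eq, h0]; simp
    simp_rw [h0, h1, sub_zero, abs_of_nonneg (heatW_nonneg _)]
    rw [lint_W x hb, lint_k2 x hb, ← ENNReal.ofReal_one, ← ENNReal.ofReal_add (by positivity) (by positivity)]
    apply ENNReal.ofReal_le_ofReal
    have : 1 ≤ ((b - a) / |a|) ^ (3 / 4 : ℝ) := by
      apply Real.one_le_rpow _ (by norm_num)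
      rw [one_le_div habs, abs_of_neg ha]; linarith
    have h5 : 2 + M2 n ≤ (2 + M2 n) * (n + 1) := by nlinarith
    nlinarith
  · set lam := (a / b) ^ (n + 1) with hlam
    have hl0 : 0 ≤ lam := by positivity
    have hab1 : a / b ≤ 1 := (div_le_one hb).mpr hab.le
    have hl1 : lam ≤ 1 := pow_le_one₀ (by positivity) hab1
    have e1 := l1_mono (k1 := fun z => heatW (x - z, a)) (k2 := fun z => heatW (x - z, b))
      (by fun_prop) (by fun_prop) (fun z => heatW_nonneg _) hl0 hl1 zero_le_one (by
        intro z
        refine le_trans ?_ (heatW_mono (x - z) ha hab.le)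
        have := heatW_nonneg (x - z, a)
        rw [hlam, pow_succ]
        have h8 : 0 ≤ (a / b) ^ n := by positivity
        gcongr
        exact mul_le_of_le_one_right h8 hab1)
      (by simpa using lint_W x ha) (by simpa using lint_W x hb)
    have ek : ∀ c : ℝ, 0 < c → ∀ v : Spc n, 1 / (2 * c) * heatW (v, c) * ‖v‖ ^ 2 = ‖v‖ * ‖gradW (v, c)‖ := by
      intro c hc v
      rw [norm_gradW _ hc]; ring
    have e2 := l1_mono (k1 := fun z => 1 / (2 * a) * heatW (x - z, a) * ‖x - z‖ ^ 2)
      (k2 := fun z => 1 / (2 * b) * heatW (x - z, b) * ‖x - z‖ ^ 2)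
      (by fun_prop) (by fun_prop) (fun z => by have := heatW_nonneg (x - z, a); positivity) hl0 hl1
      (M := M2 n / 2) (by positivity) (by
        intro z
        have h7 := heatW_mono (x - z) ha hab.le
        have h9 : lam * (1 / (2 * a) * heatW (x - z, a) * ‖x - z‖ ^ 2) =
            1 / (2 * b) * ((a / b) ^ n * heatW (x - z, a)) * ‖x - z‖ ^ 2 := by
          rw [hlam, pow_succ]; field_simp
        rw [h9]
        gcongr)
      (by simp_rw [ek a ha]; exact lint_k2 x ha) (by simp_rw [ek b hb]; exact lint_k2 x hb)
    simp_rw [grad_diff]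
    refine (add_le_add e1 e2).trans ?_
    have h1l : 0 ≤ 1 - lam := by linarith
    rw [← ENNReal.ofReal_add (by positivity) (by positivity)]
    apply ENNReal.ofReal_le_ofReal
    have hv : 1 - a / b = (b - a) / b := by field_simp
    have hbern : 1 - lam ≤ (n + 1) * ((b - a) / b) := by
      have := one_add_mul_le_pow (a := a / b - 1) (by have : 0 ≤ a / b := by positivity
                                                      linarith) (n + 1)
      rw [← hv, hlam]
      push_cast at this
      rw [show 1 + (a / b - 1) = a / b by ring] at this
      linarith
    have hr : (b - a) / b ≤ ((b - a) / |a|) ^ (3 / 4 : ℝ) := by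
      have h10 : (b - a) / b ≤ 1 := by rw [div_le_one hb]; linarith
      calc (b - a) / b = ((b - a) / b) ^ (1 : ℝ) := by simp
        _ ≤ ((b - a) / b) ^ (3 / 4 : ℝ) :=
          Real.rpow_le_rpow_of_exponent_ge (by positivity) h10 (by norm_num)
        _ ≤ _ := by
          rw [abs_of_pos ha]
          gcongr
    calc 2 * 1 * (1 - lam) + 2 * (M2 n / 2) * (1 - lam) = (2 + M2 n) * (1 - lam) := by ring
      _ ≤ (2 + M2 n) * ((n + 1) * ((b - a) / b)) := by gcongr
      _ ≤ (2 + M2 n) * ((n + 1) * ((b - a) / |a|) ^ (3 / 4 : ℝ)) := by gcongr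
      _ = _ := by ring



/-- A product cutoff function with its derivatives. -/
structure Cut (n : ℕ) where
  a : Spc n → ℝ
  A : Spc n → Spc n
  b : ℝ → ℝ
  b' : ℝ → ℝ
  ha : ∀ z, HasFDerivAt a (innerSL ℝ (A z)) z
  hb : ∀ τ, HasDerivAt b (b' τ) τ
  cA : Continuous A
  cb' : Continuous b'
  CA : ℝ
  Cb : ℝ
  a_le : ∀ z, |a z| ≤ 1
  b_le : ∀ τ, |b τ| ≤ 1
  A_le : ∀ z, ‖A z‖ ≤ CA
  b'_le : ∀ τ, |b' τ| ≤ Cb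
  T0 : ℝ
  T1 : ℝ
  b_supp : ∀ τ, τ ∉ Icc T0 T1 → b τ = 0
  b'_supp : ∀ τ, τ ∉ Icc T0 T1 → b' τ = 0

namespace Cut
variable (c : Cut n)
/-- the cutoff -/
def chi (q : Pt n) : ℝ := c.a q.1 * c.b q.2
/-- time derivative -/
def chit (q : Pt n) : ℝ := c.a q.1 * c.b' q.2
/-- spatial gradient -/
def X (q : Pt n) : Spc n := c.b q.2 • c.A q.1

lemma CA_nonneg : 0 ≤ c.CA := (norm_nonneg _).trans (c.A_le 0)
lemma Cb_nonneg : 0 ≤ c.Cb := (abs_nonneg _).trans (c.b'_le 0)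

lemma cont_a : Continuous c.a := continuous_iff_continuousAt.mpr fun z => (c.ha z).continuousAt
lemma cont_b : Continuous c.b := continuous_iff_continuousAt.mpr fun z => (c.hb z).continuousAt
lemma cont_chi : Continuous c.chi := by
  have := c.cont_a; have := c.cont_b; unfold chi; fun_prop
lemma cont_chit : Continuous c.chit := by
  have := c.cont_a; have := c.cb'; unfold chit; fun_prop
lemma cont_X : Continuous c.X := by
  have := c.cA; have := c.cont_b; unfold X; fun_prop

lemma chi_le (q : Pt n) : |c.chi q| ≤ 1 := by
  rw [chi, abs_mul]; exact mul_le_one₀ (c.a_le _) (abs_nonneg _) (c.b_le _)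
lemma chit_le (q : Pt n) : |c.chit q| ≤ c.Cb := by
  rw [chit, abs_mul]
  calc _ ≤ 1 * c.Cb := mul_le_mul (c.a_le _) (c.b'_le _) (abs_nonneg _) zero_le_one
    _ = _ := one_mul _
lemma X_le (q : Pt n) : ‖c.X q‖ ≤ c.CA := by
  rw [X, norm_smul]
  calc _ ≤ 1 * c.CA := mul_le_mul (c.b_le _) (c.A_le _) (norm_nonneg _) zero_le_one
    _ = _ := one_mul _

lemma chi_path {m : ℝ → Spc n} {m' : Spc n} {τ : ℝ} (hm : HasDerivAt m m' τ) :
    HasDerivAt (fun r => c.chi (m r, r)) (c.chit (m τ, τ) + inner ℝ (c.X (m τ, τ)) m') τ := by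
  have h1 : HasDerivAt (fun r => c.a (m r)) (inner ℝ (c.A (m τ)) m') τ := by
    have := (c.ha (m τ)).comp_hasDerivAt τ hm
    exact this.congr_deriv rfl
  have h2 := h1.mul (c.hb τ)
  refine h2.congr_deriv ?_
  simp only [chit, X, real_inner_smul_left]
  ring

lemma path_identity {t0 t1 : ℝ} (h01 : t0 < t1) {m m' : ℝ → Spc n} {s s' g : ℝ → ℝ}
    (cm : Continuous m) (cs : Continuous s) (mm' : Measurable m') (ms' : Measurable s')
    (dm : ∀ τ ∈ Ioo t0 t1, HasDerivAt m (m' τ) τ) (ds : ∀ τ ∈ Ioo t0 t1, HasDerivAt s (s' τ) τ)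
    (spos : ∀ τ ∈ Ioo t0 t1, 0 < s τ)
    (hg : IntegrableOn g (Ioo t0 t1)) (hg1 : ∀ τ ∈ Ioo t0 t1, ‖m' τ‖ ≤ g τ)
    (hg2 : ∀ τ ∈ Ioo t0 t1, |s' τ / (2 * √(s τ))| ≤ g τ) :
    ∫ ζ, heatW (ζ, 1) * (c.chi (m t1 + √(s t1) • ζ, t1) - c.chi (m t0 + √(s t0) • ζ, t0)) =
      ∫ τ in Ioo t0 t1, ∫ z, heatW (z - m τ, s τ) * (c.chit (z, τ) +
        inner ℝ (c.X (z, τ)) (m' τ + (s' τ / (2 * s τ)) • (z - m τ))) := by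
  have hW := measurable_heatW (n := n)
  have hX := c.cont_X.measurable
  have ht := c.cont_chit.measurable
  set D : Spc n → ℝ → ℝ := fun ζ τ => c.chit (m τ + √(s τ) • ζ, τ) +
    inner ℝ (c.X (m τ + √(s τ) • ζ, τ)) (m' τ + (s' τ / (2 * √(s τ))) • ζ) with hD
  have Dm : Measurable (Function.uncurry D) := by
    have := cm.measurable
    have := cs.measurable
    simp only [hD, Function.uncurry_def]
    fun_prop
  have Db : ∀ ζ, ∀ τ ∈ Ioo t0 t1, |D ζ τ| ≤ c.Cb + c.CA * (1 + ‖ζ‖) * g τ := by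
    intro ζ τ hτ
    have h1 := c.chit_le (m τ + √(s τ) • ζ, τ)
    have h2 : |inner ℝ (c.X (m τ + √(s τ) • ζ, τ)) (m' τ + (s' τ / (2 * √(s τ))) • ζ)| ≤
        c.CA * (g τ + g τ * ‖ζ‖) := by
      refine (abs_real_inner_le_norm _ _).trans ?_
      refine mul_le_mul (c.X_le _) ?_ (norm_nonneg _) c.CA_nonneg
      refine (norm_add_le _ _).trans (add_le_add (hg1 τ hτ) ?_)
      rw [norm_smul, Real.norm_eq_abs]
      exact mul_le_mul_of_nonneg_right (hg2 τ hτ) (norm_nonneg _)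
    calc |D ζ τ| ≤ _ := abs_add_le _ _
      _ ≤ c.Cb + c.CA * (g τ + g τ * ‖ζ‖) := add_le_add h1 h2
      _ = _ := by ring
  -- pathwise FTC
  have ftc : ∀ ζ, ∫ τ in Ioo t0 t1, D ζ τ =
      c.chi (m t1 + √(s t1) • ζ, t1) - c.chi (m t0 + √(s t0) • ζ, t0) := by
    intro ζ
    rw [← integral_Ioc_eq_integral_Ioo, ← intervalIntegral.integral_of_le h01.le]
    apply intervalIntegral.integral_eq_sub_of_hasDerivAt_of_le h01.le
      (f := fun τ => c.chi (m τ + √(s τ) • ζ, τ))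
    · have := c.cont_chi
      apply Continuous.continuousOn
      fun_prop
    · intro τ hτ
      have h1 : HasDerivAt (fun r => m r + √(s r) • ζ) (m' τ + (s' τ / (2 * √(s τ))) • ζ) τ :=
        (dm τ hτ).add (((ds τ hτ).sqrt (spos τ hτ).ne').smul_const ζ)
      exact c.chi_path h1
    · rw [intervalIntegrable_iff_integrableOn_Ioo_of_le h01.le]
      have hgi : IntegrableOn (fun τ => c.Cb + c.CA * (1 + ‖ζ‖) * g τ) (Ioo t0 t1) :=
        (integrableOn_const (by simp)).add (hg.const_mul _)
      refine hgi.mono' ?_ ?_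
      · exact (Dm.comp (measurable_const.prodMk measurable_id)).aestronglyMeasurable
      · filter_upwards [ae_restrict_mem measurableSet_Ioo] with τ hτ using Db ζ τ hτ
  -- Fubini
  have hIntg : Integrable (Function.uncurry fun ζ τ => heatW (ζ, 1) * D ζ τ)
      ((volume : Measure (Spc n)).prod (volume.restrict (Ioo t0 t1))) := by
    have i1 : Integrable (fun q : Spc n × ℝ => (heatW (q.1, 1) * c.Cb) * (1 : ℝ) +
        (c.CA * (heatW (q.1, 1) + heatW (q.1, 1) * ‖q.1‖)) * g q.2)
        ((volume : Measure (Spc n)).prod (volume.restrict (Ioo t0 t1))) := by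
      apply Integrable.add
      · exact Integrable.mul_prod (f := fun z : Spc n => heatW (z, 1) * c.Cb) (g := fun _ : ℝ => (1:ℝ))
          (integrable_heat1.mul_const _) (integrable_const _)
      · exact Integrable.mul_prod (f := fun z : Spc n => c.CA * (heatW (z, 1) + heatW (z, 1) * ‖z‖)) (g := g)
          ((integrable_heat1.add integrable_heat1_norm).const_mul _) hg
    refine i1.mono' ?_ ?_
    · apply Measurable.aestronglyMeasurable
      have : Measurable fun q : Spc n × ℝ => D q.1 q.2 := Dm
      simp only [Function.uncurry_def]
      fun_prop
    · have hres : (volume : Measure (Spc n)).prod (volume.restrict (Ioo t0 t1)) =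
          ((volume : Measure (Spc n)).prod volume).restrict (univ ×ˢ Ioo t0 t1) := by
        rw [← Measure.prod_restrict, Measure.restrict_univ]
      rw [hres]
      filter_upwards [ae_restrict_mem (MeasurableSet.univ.prod measurableSet_Ioo)] with q hq
      simp only [Function.uncurry_def]
      rw [norm_mul, Real.norm_of_nonneg (heatW_nonneg _), Real.norm_eq_abs]
      have := mul_le_mul_of_nonneg_left (Db q.1 q.2 hq.2) (heatW_nonneg (q.1, (1:ℝ)))
      refine this.trans (le_of_eq ?_)
      ring
  calc _ = ∫ ζ, ∫ τ in Ioo t0 t1, heatW (ζ, 1) * D ζ τ := by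
        congr 1 with ζ
        rw [integral_const_mul, ftc]
    _ = ∫ τ in Ioo t0 t1, ∫ ζ, heatW (ζ, 1) * D ζ τ := integral_integral_swap hIntg
    _ = _ := by
      apply setIntegral_congr_fun measurableSet_Ioo
      intro τ hτ
      have h1 := int_heat (m τ) (spos τ hτ) (fun z => c.chit (z, τ) +
        inner ℝ (c.X (z, τ)) (m' τ + (s' τ / (2 * s τ)) • (z - m τ)))
      simp only [smul_eq_mul] at h1
      simp only
      rw [h1]
      congr 1 with ζ
      simp only [hD]
      congr 4
      rw [add_sub_cancel_left, smul_smul]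
      congr 1
      have hp := Real.sqrt_pos.mpr (spos τ hτ)
      have e : s τ = √(s τ) * √(s τ) := (Real.mul_self_sqrt (spos τ hτ).le).symm
      rw [e]
      field_simp
      rw [Real.sqrt_sq hp.le]

end Cut

lemma integrableOn_inv_sqrt (u t : ℝ) : IntegrableOn (fun τ => 1 / √(τ - u)) (Ioo u t) := by
  rcases le_or_gt t u with h | h
  · simp [Ioo_eq_empty_of_le h]
  have h1 : IntervalIntegrable (fun x : ℝ => x ^ (-(1/2) : ℝ)) volume 0 (t - u) :=
    intervalIntegral.intervalIntegrable_rpow' (by norm_num)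
  have h2 := h1.comp_sub_right u
  rw [zero_add, sub_add_cancel] at h2
  have h3 := (intervalIntegrable_iff_integrableOn_Ioo_of_le h.le).mp h2
  refine h3.congr_fun ?_ measurableSet_Ioo
  intro x hx
  have : 0 ≤ x - u := by linarith [hx.1]
  simp only
  rw [Real.rpow_neg this, Real.sqrt_eq_rpow, one_div, one_div]

lemma integrableOn_inv_sqrt' (u t : ℝ) : IntegrableOn (fun τ => 1 / √(t - τ)) (Ioo u t) := by
  rcases le_or_gt t u with h | h
  · simp [Ioo_eq_empty_of_le h]
  have h1 : IntervalIntegrable (fun x : ℝ => x ^ (-(1/2) : ℝ)) volume 0 (t - u) :=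
    intervalIntegral.intervalIntegrable_rpow' (by norm_num)
  have h2 := (h1.comp_sub_left t).symm
  rw [sub_zero, sub_sub_cancel] at h2
  have h3 := (intervalIntegrable_iff_integrableOn_Ioo_of_le h.le).mp h2
  refine h3.congr_fun ?_ measurableSet_Ioo
  intro x hx
  have : 0 ≤ t - x := by linarith [hx.2]
  simp only
  rw [Real.rpow_neg this, Real.sqrt_eq_rpow, one_div, one_div]



/-- one-sided inverse square root -/
def hsq (v : ℝ) : ENNReal := if 0 < v then ENNReal.ofReal (1 / √v) else 0

lemma measurable_hsq : Measurable hsq := by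
  unfold hsq
  exact Measurable.ite (measurableSet_lt measurable_const measurable_id) (by fun_prop) measurable_const

/-- total mass near zero -/
def S0 : ENNReal := ∫⁻ τ in Ioo (0:ℝ) 1, ENNReal.ofReal (1 / √τ)

lemma hsq_le (v : ℝ) : hsq v ≤ 1 + (Ioo (0:ℝ) 1).indicator (fun τ => ENNReal.ofReal (1 / √τ)) v := by
  unfold hsq
  split_ifs with h
  · by_cases h1 : v < 1
    · rw [indicator_of_mem (show v ∈ Ioo (0:ℝ) 1 from ⟨h, h1⟩)]
      exact le_add_self
    · push Not at h1
      refine le_trans ?_ le_self_add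
      rw [← ENNReal.ofReal_one]
      apply ENNReal.ofReal_le_ofReal
      rw [div_le_one (Real.sqrt_pos.mpr h)]
      exact Real.one_le_sqrt.mpr h1
  · exact zero_le

lemma lint_hsq (T0 T1 u : ℝ) : ∫⁻ τ in Icc T0 T1, hsq (τ - u) ≤ volume (Icc T0 T1) + S0 := by
  calc _ ≤ ∫⁻ τ in Icc T0 T1, (1 + (Ioo (0:ℝ) 1).indicator (fun τ => ENNReal.ofReal (1 / √τ)) (τ - u)) :=
        lintegral_mono fun τ => hsq_le _
    _ = (∫⁻ τ in Icc T0 T1, 1) + ∫⁻ τ in Icc T0 T1, (Ioo (0:ℝ) 1).indicator (fun τ => ENNReal.ofReal (1 / √τ)) (τ - u) :=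
        lintegral_add_left measurable_const _
    _ ≤ volume (Icc T0 T1) + ∫⁻ τ, (Ioo (0:ℝ) 1).indicator (fun τ => ENNReal.ofReal (1 / √τ)) (τ - u) := by
        gcongr
        · simp
        · exact Measure.restrict_le_self
    _ = _ := by
        congr 1
        rw [lintegral_sub_right_eq_self (fun τ => (Ioo (0:ℝ) 1).indicator (fun τ => ENNReal.ofReal (1 / √τ)) τ) u]
        rw [lintegral_indicator measurableSet_Ioo, S0]

lemma lint_hsq' (T0 T1 u : ℝ) : ∫⁻ τ in Icc T0 T1, hsq (u - τ) ≤ volume (Icc T0 T1) + S0 := by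
  calc _ ≤ ∫⁻ τ in Icc T0 T1, (1 + (Ioo (0:ℝ) 1).indicator (fun τ => ENNReal.ofReal (1 / √τ)) (u - τ)) :=
        lintegral_mono fun τ => hsq_le _
    _ = (∫⁻ τ in Icc T0 T1, 1) + ∫⁻ τ in Icc T0 T1, (Ioo (0:ℝ) 1).indicator (fun τ => ENNReal.ofReal (1 / √τ)) (u - τ) :=
        lintegral_add_left measurable_const _
    _ ≤ volume (Icc T0 T1) + ∫⁻ τ, (Ioo (0:ℝ) 1).indicator (fun τ => ENNReal.ofReal (1 / √τ)) (u - τ) := by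
        gcongr
        · simp
        · exact Measure.restrict_le_self
    _ = _ := by
        congr 1
        rw [lintegral_sub_left_eq_self (fun τ => (Ioo (0:ℝ) 1).indicator (fun τ => ENNReal.ofReal (1 / √τ)) τ) u]
        rw [lintegral_indicator measurableSet_Ioo, S0]

/-- the dominating kernel -/
def domN (p y q : Pt n) : ENNReal :=
  ENNReal.ofReal (heatW (p - q) * heatW (q - y)) +
    ENNReal.ofReal (heatW (p - q) * ‖gradW (q - y)‖) +
    ENNReal.ofReal (‖gradW (p - q)‖ * heatW (q - y))

lemma measurable_domN : Measurable fun r : Pt n × Pt n × Pt n => domN r.1 r.2.1 r.2.2 := by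
  have hW := measurable_heatW (n := n)
  have hG := measurable_gradW (n := n)
  unfold domN
  fun_prop

/-- constant -/
def KE (n : ℕ) (T0 T1 : ℝ) : ENNReal :=
  2 * volume (Icc T0 T1) + 2 * ENNReal.ofReal (M1 n / 2) * (volume (Icc T0 T1) + S0)

lemma KE_ne_top (T0 T1 : ℝ) : KE n T0 T1 ≠ ⊤ := by
  have : S0 ≠ ⊤ := lint_inv_sqrt.ne
  unfold KE
  simp [ENNReal.mul_eq_top, this]

lemma gradW_neg_eq (z : Spc n) {s : ℝ} (hs : s ≤ 0) : gradW (z, s) = 0 := by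
  simp [gradW, not_lt.mpr hs]

lemma domN_inner (x y : Spc n) (t u τ : ℝ) :
    ∫⁻ z : Spc n, domN (x, t) (y, u) (z, τ) ≤
     (ENNReal.ofReal (heatW ((x, t) - (y, u))) + ENNReal.ofReal ‖gradW ((x, t) - (y, u))‖) *
      (2 + ENNReal.ofReal (M1 n / 2) * (hsq (τ - u) + hsq (t - τ))) := by
  have hW := measurable_heatW (n := n)
  have hG := measurable_gradW (n := n)
  simp only [domN, Prod.mk_sub_mk]
  rcases le_or_gt τ u with h | h
  · simp [heatW_neg_eq _ (sub_nonpos.mpr h), gradW_neg_eq _ (sub_nonpos.mpr h)]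
  rcases le_or_gt t τ with h' | h'
  · simp [heatW_neg_eq _ (sub_nonpos.mpr h'), gradW_neg_eq _ (sub_nonpos.mpr h')]
  have ha : 0 < t - τ := by linarith
  have hb : 0 < τ - u := by linarith
  rw [lintegral_add_left (by fun_prop), lintegral_add_left (by fun_prop)]
  have h0 := kb0 x y ha hb
  have h1 := kb1 x y ha hb
  have h2 := kb2 x y ha hb
  have e : t - τ + (τ - u) = t - u := by ring
  rw [e] at h0 h1 h2
  set w := heatW (x - y, t - u)
  have hw : 0 ≤ w := heatW_nonneg _
  set g := ‖gradW (x - y, t - u)‖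
  have hg : 0 ≤ g := norm_nonneg _
  have hM := M1_nonneg (n := n)
  have key : ∀ v : ℝ, 0 < v → ENNReal.ofReal (g + w * (M1 n / (2 * √v))) =
      ENNReal.ofReal g + ENNReal.ofReal w * (ENNReal.ofReal (M1 n / 2) * hsq v) := by
    intro v hv
    rw [hsq, if_pos hv, ← ENNReal.ofReal_mul (by positivity), ← ENNReal.ofReal_mul (by positivity),
      ← ENNReal.ofReal_add (by positivity) (by positivity)]
    congr 3
    field_simp
  rw [key _ hb] at h1
  rw [key _ ha] at h2
  calc _ ≤ ENNReal.ofReal w + (ENNReal.ofReal g + ENNReal.ofReal w * (ENNReal.ofReal (M1 n / 2) * hsq (τ - u))) +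
      (ENNReal.ofReal g + ENNReal.ofReal w * (ENNReal.ofReal (M1 n / 2) * hsq (t - τ))) :=
        add_le_add (add_le_add h0.le h1) h2
    _ = ENNReal.ofReal w + 2 * ENNReal.ofReal g + ENNReal.ofReal w * (ENNReal.ofReal (M1 n / 2) * (hsq (τ - u) + hsq (t - τ))) := by ring
    _ ≤ 2 * ENNReal.ofReal w + 2 * ENNReal.ofReal g + (ENNReal.ofReal w + ENNReal.ofReal g) * (ENNReal.ofReal (M1 n / 2) * (hsq (τ - u) + hsq (t - τ))) := by
        gcongr
        · rw [two_mul]; exact le_self_add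
        · exact le_self_add
    _ = _ := by ring

lemma lint_domN (T0 T1 : ℝ) (p y : Pt n) :
    ∫⁻ q in {q : Pt n | q.2 ∈ Icc T0 T1}, domN p y q ≤ KE n T0 T1 *
      (ENNReal.ofReal (heatW (p - y)) + ENNReal.ofReal ‖gradW (p - y)‖) := by
  have hW := measurable_heatW (n := n)
  have hG := measurable_gradW (n := n)
  obtain ⟨x, t⟩ := p
  obtain ⟨y, u⟩ := y
  have hN' : Measurable (fun q : Spc n × ℝ => domN (x, t) (y, u) q) := by
    unfold domN; fun_prop
  have e : {q : Pt n | q.2 ∈ Icc T0 T1} = (univ : Set (Spc n)) ×ˢ Icc T0 T1 := by ext; simp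
  rw [e, Measure.volume_eq_prod, ← Measure.prod_restrict, Measure.restrict_univ,
    lintegral_prod_symm _ hN'.aemeasurable]
  have mh := measurable_hsq
  calc _ ≤ ∫⁻ τ in Icc T0 T1, (ENNReal.ofReal (heatW ((x, t) - (y, u))) + ENNReal.ofReal ‖gradW ((x, t) - (y, u))‖) *
      (2 + ENNReal.ofReal (M1 n / 2) * (hsq (τ - u) + hsq (t - τ))) :=
        lintegral_mono fun τ => domN_inner x y t u τ
    _ = (ENNReal.ofReal (heatW ((x, t) - (y, u))) + ENNReal.ofReal ‖gradW ((x, t) - (y, u))‖) *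
       ((∫⁻ τ in Icc T0 T1, 2) + ENNReal.ofReal (M1 n / 2) * ((∫⁻ τ in Icc T0 T1, hsq (τ - u)) + ∫⁻ τ in Icc T0 T1, hsq (t - τ))) := by
        rw [lintegral_const_mul _ (by fun_prop), lintegral_add_left (by fun_prop),
          lintegral_const_mul _ (by fun_prop), lintegral_add_left (by fun_prop)]
    _ ≤ (ENNReal.ofReal (heatW ((x, t) - (y, u))) + ENNReal.ofReal ‖gradW ((x, t) - (y, u))‖) *
       (2 * volume (Icc T0 T1) + ENNReal.ofReal (M1 n / 2) * ((volume (Icc T0 T1) + S0) + (volume (Icc T0 T1) + S0))) := by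
        gcongr
        · rw [setLIntegral_const]
        · exact lint_hsq _ _ _
        · exact lint_hsq' _ _ _
    _ = _ := by rw [KE]; ring

lemma lint_dom0 (T0 T1 : ℝ) (p : Pt n) :
    ∫⁻ q in {q : Pt n | q.2 ∈ Icc T0 T1}, (ENNReal.ofReal (heatW (p - q)) + ENNReal.ofReal ‖gradW (p - q)‖)
     ≤ KE n T0 T1 + volume (Icc T0 T1) := by
  have hW := measurable_heatW (n := n)
  have hG := measurable_gradW (n := n)
  obtain ⟨x, t⟩ := p
  have e : {q : Pt n | q.2 ∈ Icc T0 T1} = (univ : Set (Spc n)) ×ˢ Icc T0 T1 := by ext; simp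
  rw [e, Measure.volume_eq_prod, ← Measure.prod_restrict, Measure.restrict_univ,
    lintegral_prod_symm _ (by
      apply Measurable.aemeasurable
      fun_prop)]
  have mh := measurable_hsq
  have inner : ∀ τ, ∫⁻ z : Spc n, (ENNReal.ofReal (heatW ((x, t) - (z, τ))) + ENNReal.ofReal ‖gradW ((x, t) - (z, τ))‖) ≤ 1 + ENNReal.ofReal (M1 n / 2) * hsq (t - τ) := by
    intro τ
    simp only [Prod.mk_sub_mk]
    rcases le_or_gt t τ with h' | h'
    · simp [heatW_neg_eq _ (sub_nonpos.mpr h'), gradW_neg_eq _ (sub_nonpos.mpr h')]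
    have ha : 0 < t - τ := by linarith
    have hM := M1_nonneg (n := n)
    rw [lintegral_add_left (by fun_prop), lint_W _ ha, lint_gradW _ ha, hsq, if_pos ha,
      ← ENNReal.ofReal_mul (by positivity)]
    apply le_of_eq
    congr 2
    field_simp
  calc _ ≤ ∫⁻ τ in Icc T0 T1, (1 + ENNReal.ofReal (M1 n / 2) * hsq (t - τ)) :=
        lintegral_mono inner
    _ = (∫⁻ τ in Icc T0 T1, 1) + ENNReal.ofReal (M1 n / 2) * ∫⁻ τ in Icc T0 T1, hsq (t - τ) := by
        rw [lintegral_add_left (by fun_prop), lintegral_const_mul _ (by fun_prop)]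
    _ ≤ volume (Icc T0 T1) + ENNReal.ofReal (M1 n / 2) * (volume (Icc T0 T1) + S0) := by
        gcongr
        · simp
        · exact lint_hsq' _ _ _
    _ ≤ _ := by
        rw [KE, add_comm]
        gcongr
        rw [two_mul (ENNReal.ofReal _), add_mul]
        exact le_trans le_self_add le_add_self

lemma K0_ne_top (T0 T1 : ℝ) : KE n T0 T1 + volume (Icc T0 T1) ≠ ⊤ := by
  simp [KE_ne_top]


namespace Cut
variable (c : Cut n)

lemma chit_supp {q : Pt n} (h : q.2 ∉ Icc c.T0 c.T1) : c.chit q = 0 := by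
  simp [chit, c.b'_supp _ h]
lemma X_supp {q : Pt n} (h : q.2 ∉ Icc c.T0 c.T1) : c.X q = 0 := by
  simp [X, c.b_supp _ h]

/-- bilinear kernel -/
def Gam (p y q : Pt n) : ℝ :=
  heatW (p - q) * heatW (q - y) * c.chit q - heatW (p - q) * inner ℝ (c.X q) (gradW (q - y))
    - heatW (q - y) * inner ℝ (c.X q) (gradW (p - q))

/-- linear kernel -/
def Gam0 (p q : Pt n) : ℝ := heatW (p - q) * c.chit q - inner ℝ (c.X q) (gradW (p - q))

lemma measurable_Gam : Measurable fun r : Pt n × Pt n × Pt n => c.Gam r.1 r.2.1 r.2.2 := by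
  have hW := measurable_heatW (n := n)
  have hG := measurable_gradW (n := n)
  have hX := c.cont_X.measurable
  have ht := c.cont_chit.measurable
  unfold Gam
  fun_prop

/-- max of the constants -/
def CC : ℝ := c.Cb + c.CA
lemma CC_nonneg : 0 ≤ c.CC := add_nonneg c.Cb_nonneg c.CA_nonneg

lemma inner_le (q : Pt n) (v : Spc n) : |inner ℝ (c.X q) v| ≤ c.CC * ‖v‖ := by
  refine (abs_real_inner_le_norm _ _).trans ?_
  refine mul_le_mul_of_nonneg_right ((c.X_le q).trans ?_) (norm_nonneg _)
  have := c.Cb_nonneg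
  simp only [CC]; linarith

lemma chit_le' (q : Pt n) : |c.chit q| ≤ c.CC := by
  have := c.CA_nonneg
  refine (c.chit_le q).trans ?_
  simp only [CC]; linarith

/-- indicator of the time support -/
def J : Set (Pt n) := {q | q.2 ∈ Icc c.T0 c.T1}
lemma mJ : MeasurableSet c.J := measurable_snd measurableSet_Icc

lemma g1_le (p y q : Pt n) : ‖heatW (p - q) * heatW (q - y) * c.chit q‖ₑ ≤
    c.J.indicator (fun q => ENNReal.ofReal c.CC * domN p y q) q := by
  by_cases h : q ∈ c.J
  · rw [indicator_of_mem h]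
    have hp : 0 ≤ heatW (p - q) * heatW (q - y) := mul_nonneg (heatW_nonneg _) (heatW_nonneg _)
    calc _ ≤ ENNReal.ofReal (c.CC * (heatW (p - q) * heatW (q - y))) := by
          rw [← ofReal_norm]
          apply ENNReal.ofReal_le_ofReal
          rw [norm_mul, Real.norm_of_nonneg hp, mul_comm]
          exact mul_le_mul_of_nonneg_right (c.chit_le' q) hp
      _ ≤ _ := by
          rw [ENNReal.ofReal_mul c.CC_nonneg, domN]
          gcongr
          rw [add_assoc]; exact le_self_add
  · simp [c.chit_supp h]

lemma g2_le (p y q : Pt n) : ‖heatW (p - q) * inner ℝ (c.X q) (gradW (q - y))‖ₑ ≤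
    c.J.indicator (fun q => ENNReal.ofReal c.CC * domN p y q) q := by
  by_cases h : q ∈ c.J
  · rw [indicator_of_mem h]
    calc _ ≤ ENNReal.ofReal (c.CC * (heatW (p - q) * ‖gradW (q - y)‖)) := by
          rw [← ofReal_norm]
          apply ENNReal.ofReal_le_ofReal
          rw [norm_mul, Real.norm_of_nonneg (heatW_nonneg _), mul_left_comm]
          exact mul_le_mul_of_nonneg_left (c.inner_le q _) (heatW_nonneg _)
      _ ≤ _ := by
          rw [ENNReal.ofReal_mul c.CC_nonneg, domN]
          gcongr
          exact le_trans le_add_self le_self_add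
  · simp [c.X_supp h]

lemma g3_le (p y q : Pt n) : ‖heatW (q - y) * inner ℝ (c.X q) (gradW (p - q))‖ₑ ≤
    c.J.indicator (fun q => ENNReal.ofReal c.CC * domN p y q) q := by
  by_cases h : q ∈ c.J
  · rw [indicator_of_mem h]
    calc _ ≤ ENNReal.ofReal (c.CC * (‖gradW (p - q)‖ * heatW (q - y))) := by
          rw [← ofReal_norm]
          apply ENNReal.ofReal_le_ofReal
          rw [norm_mul, Real.norm_of_nonneg (heatW_nonneg _), mul_comm, ← mul_assoc]
          exact mul_le_mul_of_nonneg_right (c.inner_le q _) (heatW_nonneg _)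
      _ ≤ _ := by
          rw [ENNReal.ofReal_mul c.CC_nonneg, domN]
          gcongr
          exact le_add_self
  · simp [c.X_supp h]

lemma lint_ind (p y : Pt n) :
    ∫⁻ q, c.J.indicator (fun q => ENNReal.ofReal c.CC * domN p y q) q ≤
      ENNReal.ofReal c.CC * (KE n c.T0 c.T1 *
      (ENNReal.ofReal (heatW (p - y)) + ENNReal.ofReal ‖gradW (p - y)‖)) := by
  have hW := measurable_heatW (n := n)
  have hG := measurable_gradW (n := n)
  rw [lintegral_indicator c.mJ, lintegral_const_mul _ (by unfold domN; fun_prop)]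
  gcongr
  exact lint_domN _ _ _ _

lemma lint_ind_lt (p y : Pt n) :
    ∫⁻ q, c.J.indicator (fun q => ENNReal.ofReal c.CC * domN p y q) q < ⊤ := by
  refine (c.lint_ind p y).trans_lt ?_
  have := KE_ne_top (n := n) c.T0 c.T1
  exact ENNReal.mul_lt_top ENNReal.ofReal_lt_top (ENNReal.mul_lt_top this.lt_top (by simp))

lemma integrable_Gam (p y : Pt n) : Integrable (c.Gam p y) := by
  have hW := measurable_heatW (n := n)
  have hG := measurable_gradW (n := n)
  have hX := c.cont_X.measurable
  have ht := c.cont_chit.measurable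
  refine Integrable.sub (Integrable.sub ?_ ?_) ?_
  · exact ⟨(by apply Measurable.aestronglyMeasurable; fun_prop), (lintegral_mono (c.g1_le p y)).trans_lt (c.lint_ind_lt p y)⟩
  · exact ⟨(by apply Measurable.aestronglyMeasurable; fun_prop), (lintegral_mono (c.g2_le p y)).trans_lt (c.lint_ind_lt p y)⟩
  · exact ⟨(by apply Measurable.aestronglyMeasurable; fun_prop), (lintegral_mono (c.g3_le p y)).trans_lt (c.lint_ind_lt p y)⟩

lemma h1_le (p q : Pt n) : ‖heatW (p - q) * c.chit q‖ₑ ≤ c.J.indicator (fun q => ENNReal.ofReal c.CC *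
    (ENNReal.ofReal (heatW (p - q)) + ENNReal.ofReal ‖gradW (p - q)‖)) q := by
  by_cases h : q ∈ c.J
  · rw [indicator_of_mem h]
    calc _ ≤ ENNReal.ofReal (c.CC * (heatW (p - q))) := by
          rw [← ofReal_norm]
          apply ENNReal.ofReal_le_ofReal
          rw [norm_mul, Real.norm_of_nonneg (heatW_nonneg _), mul_comm]
          exact mul_le_mul_of_nonneg_right (c.chit_le' q) (heatW_nonneg _)
      _ ≤ _ := by
          rw [ENNReal.ofReal_mul c.CC_nonneg]
          gcongr
          exact le_self_add
  · simp [c.chit_supp h]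

lemma h2_le (p q : Pt n) : ‖(inner ℝ (c.X q) (gradW (p - q)) : ℝ)‖ₑ ≤ c.J.indicator (fun q => ENNReal.ofReal c.CC *
    (ENNReal.ofReal (heatW (p - q)) + ENNReal.ofReal ‖gradW (p - q)‖)) q := by
  by_cases h : q ∈ c.J
  · rw [indicator_of_mem h]
    calc _ ≤ ENNReal.ofReal (c.CC * ‖gradW (p - q)‖) := by
          rw [← ofReal_norm]
          apply ENNReal.ofReal_le_ofReal
          exact c.inner_le q _
      _ ≤ _ := by
          rw [ENNReal.ofReal_mul c.CC_nonneg]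
          gcongr
          exact le_add_self
  · simp [c.X_supp h]

lemma lint_ind0_lt (p : Pt n) : ∫⁻ q, c.J.indicator (fun q => ENNReal.ofReal c.CC *
    (ENNReal.ofReal (heatW (p - q)) + ENNReal.ofReal ‖gradW (p - q)‖)) q < ⊤ := by
  have hW := measurable_heatW (n := n)
  have hG := measurable_gradW (n := n)
  rw [lintegral_indicator c.mJ, lintegral_const_mul _ (by fun_prop)]
  exact ENNReal.mul_lt_top ENNReal.ofReal_lt_top ((lint_dom0 _ _ _).trans_lt (K0_ne_top (n := n) c.T0 c.T1).lt_top)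

lemma integrable_h1 (p : Pt n) : Integrable (fun q => heatW (p - q) * c.chit q) := by
  have hW := measurable_heatW (n := n)
  have ht := c.cont_chit.measurable
  exact ⟨(by apply Measurable.aestronglyMeasurable; fun_prop), (lintegral_mono (c.h1_le p)).trans_lt (c.lint_ind0_lt p)⟩
lemma integrable_h2 (p : Pt n) : Integrable (fun q => (inner ℝ (c.X q) (gradW (p - q)) : ℝ)) := by
  have hG := measurable_gradW (n := n)
  have hX := c.cont_X.measurable
  exact ⟨(by apply Measurable.aestronglyMeasurable; fun_prop), (lintegral_mono (c.h2_le p)).trans_lt (c.lint_ind0_lt p)⟩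

lemma integrable_Gam0 (p : Pt n) : Integrable (c.Gam0 p) := (c.integrable_h1 p).sub (c.integrable_h2 p)

lemma bridge_identity (p y : Pt n) (hy : c.chi y = 0) : c.chi p * heatW (p - y) = ∫ q, c.Gam p y q := by
  obtain ⟨x, t⟩ := p
  obtain ⟨y, u⟩ := y
  have hI := c.integrable_Gam (x, t) (y, u)
  rw [Measure.volume_eq_prod] at hI ⊢
  rw [integral_prod_symm _ hI]
  have hz : ∀ τ, τ ∉ Ioo u t → ∫ z : Spc n, c.Gam (x, t) (y, u) (z, τ) = 0 := by
    intro τ hτ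
    have : ∀ z : Spc n, c.Gam (x, t) (y, u) (z, τ) = 0 := by
      intro z
      simp only [Gam, Prod.mk_sub_mk]
      rcases le_or_gt τ u with h | h
      · simp [heatW_neg_eq _ (sub_nonpos.mpr h), gradW_neg_eq _ (sub_nonpos.mpr h)]
      rcases le_or_gt t τ with h' | h'
      · simp [heatW_neg_eq _ (sub_nonpos.mpr h'), gradW_neg_eq _ (sub_nonpos.mpr h')]
      exact absurd ⟨h, h'⟩ hτ
    simp [this]
  rw [← setIntegral_eq_integral_of_forall_compl_eq_zero hz]
  rcases le_or_gt t u with htu | htu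
  · simp [Ioo_eq_empty_of_le htu, heatW_neg_eq _ (sub_nonpos.mpr htu)]
  have htu0 : 0 < t - u := by linarith
  set s : ℝ → ℝ := fun τ => (t - τ) * (τ - u) / (t - u) with hs
  set s' : ℝ → ℝ := fun τ => ((t - τ) - (τ - u)) / (t - u) with hs'
  set m : ℝ → Spc n := fun τ => y + ((τ - u) / (t - u)) • (x - y) with hm
  set m' : ℝ → Spc n := fun τ => (1 / (t - u)) • (x - y) with hm'
  have spos : ∀ τ ∈ Ioo u t, 0 < s τ := by
    intro τ hτ
    have h1 : 0 < t - τ := by linarith [hτ.2]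
    have h2 : 0 < τ - u := by linarith [hτ.1]
    simp only [hs]; positivity
  have key := c.path_identity htu (m := m) (m' := m') (s := s) (s' := s')
    (g := fun τ => ‖x - y‖ / (t - u) + (1 / √(τ - u) + 1 / √(t - τ)))
    (by simp only [hm]; fun_prop) (by simp only [hs]; fun_prop)
    (by simp only [hm']; fun_prop) (by simp only [hs']; fun_prop)
    (by
      intro τ _
      have h1 : HasDerivAt (fun τ : ℝ => (τ - u) / (t - u)) (1 / (t - u)) τ :=
        ((hasDerivAt_id τ).sub_const u).div_const _
      exact (h1.smul_const (x - y)).const_add y)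
    (by
      intro τ _
      have h1 : HasDerivAt (fun τ : ℝ => t - τ) (-1) τ := (hasDerivAt_id τ).const_sub t
      have h2 : HasDerivAt (fun τ : ℝ => τ - u) 1 τ := (hasDerivAt_id τ).sub_const u
      refine ((h1.mul h2).div_const (t - u)).congr_deriv ?_
      simp only [hs']; ring)
    spos
    (by
      refine (integrableOn_const (by simp)).add ((integrableOn_inv_sqrt u t).add (integrableOn_inv_sqrt' u t)))
    (by
      intro τ hτ
      simp only [hm', norm_smul, Real.norm_eq_abs, abs_of_pos (one_div_pos.mpr htu0)]
      have : 1 / (t - u) * ‖x - y‖ = ‖x - y‖ / (t - u) := by ring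
      rw [this]
      exact le_add_of_nonneg_right (by positivity))
    (by
      intro τ hτ
      have h1 : 0 < t - τ := by linarith [hτ.2]
      have h2 : 0 < τ - u := by linarith [hτ.1]
      have r1 := Real.sqrt_pos.mpr h1
      have r2 := Real.sqrt_pos.mpr h2
      have r3 := Real.sqrt_pos.mpr htu0
      have e1 : √(s τ) = √(t - τ) * √(τ - u) / √(t - u) := by
        simp only [hs]; rw [Real.sqrt_div (by positivity), Real.sqrt_mul h1.le]
      have b1 : |s' τ| ≤ 1 := by
        simp only [hs']
        rw [abs_div, abs_of_pos htu0, div_le_one htu0, abs_le]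
        constructor <;> linarith
      have b2 : √(t - u) ≤ √(t - τ) + √(τ - u) := by
        rw [Real.sqrt_le_left (by positivity)]
        nlinarith [Real.sq_sqrt h1.le, Real.sq_sqrt h2.le, mul_pos r1 r2]
      calc |s' τ / (2 * √(s τ))| = |s' τ| * (√(t - u) / (2 * (√(t - τ) * √(τ - u)))) := by
            rw [abs_div, abs_of_pos (a := 2 * √(s τ)) (by rw [e1]; positivity), e1]; field_simp
        _ ≤ 1 * ((√(t - τ) + √(τ - u)) / (1 * (√(t - τ) * √(τ - u)))) := by
            gcongr
            norm_num
        _ = 1 / √(τ - u) + 1 / √(t - τ) := by field_simp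
        _ ≤ _ := le_add_of_nonneg_left (by positivity))
  have endp : ∫ ζ : Spc n, heatW (ζ, 1) * (c.chi (m t + √(s t) • ζ, t) - c.chi (m u + √(s u) • ζ, u))
      = c.chi (x, t) := by
    have e1 : m t = x := by simp [hm, div_self htu0.ne']
    have e2 : m u = y := by simp [hm]
    have e3 : s t = 0 := by simp [hs]
    have e4 : s u = 0 := by simp [hs]
    rw [e1, e2, e3, e4]
    simp only [Real.sqrt_zero, zero_smul, add_zero, hy, sub_zero]
    rw [integral_mul_const, integral_heat1, one_mul]
  rw [← endp, key, mul_comm, ← integral_const_mul]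
  apply setIntegral_congr_fun measurableSet_Ioo
  intro τ hτ
  simp only
  rw [← integral_const_mul]
  congr 1 with z
  have h1 : 0 < t - τ := by linarith [hτ.2]
  have h2 : 0 < τ - u := by linarith [hτ.1]
  have hp := heat_prod x y z h1 h2
  have e : t - τ + (τ - u) = t - u := by ring
  rw [e] at hp
  have hV : m' τ + (s' τ / (2 * s τ)) • (z - m τ) =
      (1 / (2 * (τ - u))) • (z - y) + (1 / (2 * (t - τ))) • (x - z) := by
    have ex : x = (x - y) + y := by simp
    have hz' : z = (z - y) + y := by simp
    have a1 : z - m τ = (z - y) - ((τ - u) / (t - u)) • (x - y) := by simp only [hm]; abel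
    have a2 : x - z = (x - y) - (z - y) := by abel
    rw [a1, a2]
    simp only [hm', hs', hs]
    generalize x - y = P
    generalize z - y = R
    rw [smul_sub, smul_sub, smul_smul]
    have c1 : (t - τ - (τ - u)) / (t - u) / (2 * ((t - τ) * (τ - u) / (t - u))) =
      1 / (2 * (τ - u)) - 1 / (2 * (t - τ)) := by field_simp
    rw [c1]
    have c2 : (1 / (2 * (τ - u)) - 1 / (2 * (t - τ))) * ((τ - u) / (t - u)) = 1 / (t - u) - 1 / (2 * (t - τ)) := by
      field_simp; ring
    rw [c2]
    simp only [sub_smul]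
    abel
  rw [hV, ← mul_assoc]
  simp only [Prod.mk_sub_mk]
  have : heatW (x - y, t - u) * heatW (z - m τ, s τ) = heatW (x - z, t - τ) * heatW (z - y, τ - u) := by
    rw [hp]
  rw [this]
  simp only [Gam, Prod.mk_sub_mk, gradW_eq, inner_add_right, real_inner_smul_right]
  ring

lemma const_identity (p : Pt n) : c.chi p = ∫ q, c.Gam0 p q := by
  obtain ⟨x, t⟩ := p
  have hI := c.integrable_Gam0 (x, t)
  rw [Measure.volume_eq_prod] at hI ⊢
  rw [integral_prod_symm _ hI]
  set u := min c.T0 t - 1 with hu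
  have hu1 : u < c.T0 := by have := min_le_left c.T0 t; linarith
  have hu2 : u < t := by have := min_le_right c.T0 t; linarith
  have hz : ∀ τ, τ ∉ Ioo u t → ∫ z : Spc n, c.Gam0 (x, t) (z, τ) = 0 := by
    intro τ hτ
    have : ∀ z : Spc n, c.Gam0 (x, t) (z, τ) = 0 := by
      intro z
      simp only [Gam0, Prod.mk_sub_mk]
      rcases le_or_gt τ u with h | h
      · have : τ ∉ Icc c.T0 c.T1 := fun h' => by linarith [h'.1]
        rw [c.chit_supp (q := (z, τ)) this, c.X_supp (q := (z, τ)) this]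
        simp
      rcases le_or_gt t τ with h' | h'
      · simp [heatW_neg_eq _ (sub_nonpos.mpr h'), gradW_neg_eq _ (sub_nonpos.mpr h')]
      exact absurd ⟨h, h'⟩ hτ
    simp [this]
  rw [← setIntegral_eq_integral_of_forall_compl_eq_zero hz]
  have key := c.path_identity hu2 (m := fun _ => x) (m' := fun _ => 0) (s := fun τ => t - τ) (s' := fun _ => -1)
    (g := fun τ => 1 / √(t - τ)) (by fun_prop) (by fun_prop) (by fun_prop) (by fun_prop)
    (fun τ _ => hasDerivAt_const _ _) (fun τ _ => (hasDerivAt_id τ).const_sub t)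
    (fun τ hτ => by linarith [hτ.2]) (integrableOn_inv_sqrt' u t)
    (fun τ _ => by simp) (by
      intro τ hτ
      have h1 : 0 < t - τ := by linarith [hτ.2]
      have r1 := Real.sqrt_pos.mpr h1
      rw [abs_div, abs_neg, abs_one, abs_of_pos (by positivity)]
      gcongr
      linarith)
  have endp : ∫ ζ : Spc n, heatW (ζ, 1) * (c.chi (x + √(t - t) • ζ, t) - c.chi (x + √(t - u) • ζ, u))
      = c.chi (x, t) := by
    have : ∀ z, c.chi (z, u) = 0 := by
      intro z
      have : u ∉ Icc c.T0 c.T1 := fun h' => by linarith [h'.1]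
      simp [chi, c.b_supp _ this]
    simp only [this, sub_self, Real.sqrt_zero, zero_smul, add_zero, sub_zero]
    rw [integral_mul_const, integral_heat1, one_mul]
  rw [← endp, key]
  apply setIntegral_congr_fun measurableSet_Ioo
  intro τ hτ
  simp only
  congr 1 with z
  have h1 : 0 < t - τ := by linarith [hτ.2]
  simp only [Gam0, Prod.mk_sub_mk, gradW_eq, zero_add, real_inner_smul_right]
  rw [heatW_sub_comm z x]
  have : inner ℝ (c.X (z, τ)) (z - x) = - inner ℝ (c.X (z, τ)) (x - z) := by
    rw [← inner_neg_right, neg_sub]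
  rw [this]
  field_simp
  ring

end Cut



lemma int_sub3 {α : Type*} [MeasurableSpace α] {μ : Measure α} {f g h : α → ℝ} (hf : Integrable f μ)
    (hg : Integrable g μ) (hh : Integrable h μ) :
    ∫ x, (f x - g x - h x) ∂μ = ∫ x, f x ∂μ - ∫ x, g x ∂μ - ∫ x, h x ∂μ := by
  have h1 := integral_sub (hf.sub hg) hh
  have h2 := integral_sub hf hg
  simp only [Pi.sub_apply] at h1
  rw [h1, h2]

/-- absolutely convergent potentials at `p` -/
def GoodM (μ : Measure (Pt n)) (p : Pt n) : Prop :=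
  Integrable (fun y => heatW (p - y)) μ ∧ Integrable (fun y => gradW (p - y)) μ

lemma ae_goodM (μ : Measure (Pt n)) [IsFiniteMeasure μ] : ∀ᵐ p, GoodM μ p :=
  tonelli μ id measurable_id

namespace Cut
variable (c : Cut n)

/-- representation integrand -/
def R (F : Pt n → ℝ) (H : Pt n → Spc n) (p q : Pt n) : ℝ :=
  heatW (p - q) * c.chit q * F q - heatW (p - q) * inner ℝ (c.X q) (H q)
    - inner ℝ (c.X q) (gradW (p - q)) * F q

lemma joint_integrable (μ : Measure (Pt n)) [IsFiniteMeasure μ] (p : Pt n) (hp : GoodM μ p) :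
    Integrable (fun r : Pt n × Pt n => c.Gam p r.2 r.1) ((volume : Measure (Pt n)).prod μ) := by
  have hW := measurable_heatW (n := n)
  have hG := measurable_gradW (n := n)
  have hX := c.cont_X.measurable
  have ht := c.cont_chit.measurable
  have hm : Measurable (fun r : Pt n × Pt n => c.Gam p r.2 r.1) := by
    unfold Gam; fun_prop
  refine ⟨hm.aestronglyMeasurable, ?_⟩
  rw [hasFiniteIntegral_iff_enorm, lintegral_prod_symm _ hm.enorm.aemeasurable]
  have h1 : ∀ y : Pt n, ∫⁻ q, ‖c.Gam p y q‖ₑ ≤ (3 * ENNReal.ofReal c.CC * KE n c.T0 c.T1) *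
      (ENNReal.ofReal (heatW (p - y)) + ENNReal.ofReal ‖gradW (p - y)‖) := by
    intro y
    calc _ ≤ ∫⁻ q, 3 * c.J.indicator (fun q => ENNReal.ofReal c.CC * domN p y q) q := by
          apply lintegral_mono
          intro q
          have a1 := c.g1_le p y q
          have a2 := c.g2_le p y q
          have a3 := c.g3_le p y q
          simp only [Gam]
          refine (enorm_sub_le).trans ((add_le_add (enorm_sub_le.trans (add_le_add a1 a2)) a3).trans (le_of_eq ?_))
          ring
      _ = 3 * ∫⁻ q, c.J.indicator (fun q => ENNReal.ofReal c.CC * domN p y q) q := by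
          rw [lintegral_const_mul]
          apply Measurable.indicator _ c.mJ
          unfold domN; fun_prop
      _ ≤ 3 * (ENNReal.ofReal c.CC * (KE n c.T0 c.T1 *
            (ENNReal.ofReal (heatW (p - y)) + ENNReal.ofReal ‖gradW (p - y)‖))) := by
          gcongr
          exact c.lint_ind p y
      _ = _ := by ring
  refine (lintegral_mono h1).trans_lt ?_
  rw [lintegral_const_mul _ (by fun_prop), lintegral_add_left (by fun_prop)]
  have k1 : ∫⁻ y, ENNReal.ofReal (heatW (p - y)) ∂μ < ⊤ := by
    have := hp.1.2
    rw [hasFiniteIntegral_iff_norm] at this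
    refine lt_of_le_of_lt (lintegral_mono fun y => ?_) this
    exact ENNReal.ofReal_le_ofReal (le_abs_self _)
  have k2 : ∫⁻ y, ENNReal.ofReal ‖gradW (p - y)‖ ∂μ < ⊤ := by
    have := hp.2.2
    rwa [hasFiniteIntegral_iff_norm] at this
  have := (KE_ne_top (n := n) c.T0 c.T1).lt_top
  exact ENNReal.mul_lt_top (ENNReal.mul_lt_top (ENNReal.mul_lt_top (by simp) (by simp)) this)
    (ENNReal.add_lt_top.mpr ⟨k1, k2⟩)

lemma rep (μ : Measure (Pt n)) [IsFiniteMeasure μ] (hμ : ∀ᵐ y ∂μ, c.chi y = 0) (p : Pt n) (hp : GoodM μ p) :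
    Integrable (c.R (mconvW μ) (mconvGradW μ) p) ∧
      c.chi p * mconvW μ p = ∫ q, c.R (mconvW μ) (mconvGradW μ) p q := by
  have hj := c.joint_integrable μ p hp
  have hae : (fun q => ∫ y, c.Gam p y q ∂μ) =ᵐ[volume] c.R (mconvW μ) (mconvGradW μ) p := by
    filter_upwards [ae_goodM μ] with q hq
    have i1 : Integrable (fun y => heatW (p - q) * heatW (q - y) * c.chit q) μ :=
      (hq.1.const_mul _).mul_const _
    have i2 : Integrable (fun y => heatW (p - q) * inner ℝ (c.X q) (gradW (q - y))) μ :=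
      (hq.2.const_inner _).const_mul _
    have i3 : Integrable (fun y => heatW (q - y) * inner ℝ (c.X q) (gradW (p - q))) μ :=
      hq.1.mul_const _
    simp only [Gam, R, mconvW, mconvGradW]
    rw [int_sub3 i1 i2 i3, integral_mul_const, integral_const_mul,
      integral_const_mul, integral_mul_const, integral_inner hq.2]
    ring
  refine ⟨hj.integral_prod_left.congr hae, ?_⟩
  rw [← integral_congr_ae hae, integral_integral_swap (f := fun q y => c.Gam p y q) hj]
  rw [mconvW, ← integral_const_mul]
  apply integral_congr_ae
  filter_upwards [hμ] with y hy
  exact c.bridge_identity p y hy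

end Cut

/-- good points for the signed measure -/
def Good (ν : SignedMeasure (Pt n)) (p : Pt n) : Prop :=
  GoodM ν.toJordanDecomposition.posPart p ∧ GoodM ν.toJordanDecomposition.negPart p

lemma ae_good (ν : SignedMeasure (Pt n)) : ∀ᵐ p, Good ν p := by
  filter_upwards [ae_goodM ν.toJordanDecomposition.posPart, ae_goodM ν.toJordanDecomposition.negPart]
    with p h1 h2 using ⟨h1, h2⟩

lemma Cut.rep_signed (c : Cut n) (ν : SignedMeasure (Pt n)) (hν : ν.totalVariation {y | c.chi y ≠ 0} = 0)
    (k : ℝ) (p : Pt n) (hp : Good ν p) :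
    Integrable (c.R (fun q => convW ν q - k) (convGradW ν) p) ∧
      c.chi p * (convW ν p - k) = ∫ q, c.R (fun q => convW ν q - k) (convGradW ν) p q := by
  have hpos : ∀ᵐ y ∂ν.toJordanDecomposition.posPart, c.chi y = 0 := by
    rw [ae_iff]
    simp only [SignedMeasure.totalVariation, Measure.add_apply, add_eq_zero] at hν
    exact hν.1
  have hneg : ∀ᵐ y ∂ν.toJordanDecomposition.negPart, c.chi y = 0 := by
    rw [ae_iff]
    simp only [SignedMeasure.totalVariation, Measure.add_apply, add_eq_zero] at hν
    exact hν.2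
  obtain ⟨i1, e1⟩ := c.rep _ hpos p hp.1
  obtain ⟨i2, e2⟩ := c.rep _ hneg p hp.2
  have i3 := c.integrable_Gam0 p
  have e3 := c.const_identity p
  have heq : c.R (fun q => convW ν q - k) (convGradW ν) p = fun q =>
      c.R (mconvW ν.toJordanDecomposition.posPart) (mconvGradW ν.toJordanDecomposition.posPart) p q -
      c.R (mconvW ν.toJordanDecomposition.negPart) (mconvGradW ν.toJordanDecomposition.negPart) p q -
      k * c.Gam0 p q := by
    ext q
    have a1 : convW ν q = mconvW ν.toJordanDecomposition.posPart q - mconvW ν.toJordanDecomposition.negPart q := rfl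
    have a2 : convGradW ν q = mconvGradW ν.toJordanDecomposition.posPart q - mconvGradW ν.toJordanDecomposition.negPart q := rfl
    simp only [Cut.R, Cut.Gam0, a1, a2, inner_sub_right]
    ring
  have a1 : convW ν p = mconvW ν.toJordanDecomposition.posPart p - mconvW ν.toJordanDecomposition.negPart p := rfl
  rw [heq]
  refine ⟨(i1.sub i2).sub (i3.const_mul k), ?_⟩
  simp only
  rw [int_sub3 i1 i2 (i3.const_mul k), integral_const_mul, ← e1, ← e2, ← e3, a1]
  ring



/-- smooth profile -/
def psi (r : ℝ) : ℝ := Real.smoothTransition (2 - r)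

lemma psi_contDiff : ContDiff ℝ 1 psi := by
  have : ContDiff ℝ 1 Real.smoothTransition := Real.smoothTransition.contDiff
  exact this.comp (contDiff_const.sub contDiff_id)

lemma psi_nonneg (r : ℝ) : 0 ≤ psi r := Real.smoothTransition.nonneg _
lemma psi_le_one (r : ℝ) : psi r ≤ 1 := Real.smoothTransition.le_one _
lemma psi_one {r : ℝ} (h : r ≤ 1) : psi r = 1 := Real.smoothTransition.one_of_one_le (by linarith)
lemma psi_zero {r : ℝ} (h : 2 ≤ r) : psi r = 0 := Real.smoothTransition.zero_of_nonpos (by linarith)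
lemma psi_abs (r : ℝ) : |psi r| ≤ 1 := by rw [abs_of_nonneg (psi_nonneg r)]; exact psi_le_one r

lemma psi_hasDeriv (r : ℝ) : HasDerivAt psi (deriv psi r) r :=
  (psi_contDiff.differentiable (by norm_num) r).hasDerivAt

lemma psi_deriv_cont : Continuous (deriv psi) := psi_contDiff.continuous_deriv (by norm_num)

lemma psi_deriv_supp {r : ℝ} (h : r ∉ Icc (1:ℝ) 2) : deriv psi r = 0 := by
  rw [mem_Icc, not_and_or, not_le, not_le] at h
  rcases h with h | h
  · have : psi =ᶠ[nhds r] fun _ => 1 := by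
      filter_upwards [Iio_mem_nhds h] with s hs using psi_one (le_of_lt hs)
    rw [this.deriv_eq]; simp
  · have : psi =ᶠ[nhds r] fun _ => 0 := by
      filter_upwards [Ioi_mem_nhds h] with s hs using psi_zero (le_of_lt hs)
    rw [this.deriv_eq]; simp

lemma exists_C0 : ∃ C, ∀ r, ‖deriv psi r‖ ≤ C :=
  psi_deriv_cont.bounded_above_of_compact_support
    (HasCompactSupport.intro isCompact_Icc fun _ h => psi_deriv_supp h)

/-- bound of the derivative of the profile -/
def C0 : ℝ := Classical.choose exists_C0
lemma psi_deriv_le (r : ℝ) : |deriv psi r| ≤ C0 := Classical.choose_spec exists_C0 r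
lemma C0_nonneg : 0 ≤ C0 := (abs_nonneg _).trans (psi_deriv_le 0)

/-- gradient of spatial part -/
def mkA (x0 : Spc n) (l : ℝ) (z : Spc n) : Spc n := (deriv psi (‖z - x0‖ ^ 2 / l ^ 2) * (2 / l ^ 2)) • (z - x0)
/-- derivative of time part -/
def mkb' (t0 l τ : ℝ) : ℝ := deriv psi ((τ - t0) ^ 2 / l ^ 4) * (2 * (τ - t0) / l ^ 4)

lemma mkA_supp {x0 : Spc n} {l : ℝ} (hl : 0 < l) {z : Spc n} (h : mkA x0 l z ≠ 0) :
    l ≤ ‖z - x0‖ ∧ ‖z - x0‖ ≤ 2 * l := by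
  have h1 : ‖z - x0‖ ^ 2 / l ^ 2 ∈ Icc (1:ℝ) 2 := by
    by_contra h2
    exact h (by simp [mkA, psi_deriv_supp h2])
  rw [mem_Icc, le_div_iff₀ (by positivity), div_le_iff₀ (by positivity)] at h1
  have := norm_nonneg (z - x0)
  constructor
  · nlinarith
  · nlinarith

lemma mkb'_supp {t0 l τ : ℝ} (hl : 0 < l) (h : mkb' t0 l τ ≠ 0) : |τ - t0| ≤ 2 * l ^ 2 := by
  have h1 : (τ - t0) ^ 2 / l ^ 4 ∈ Icc (1:ℝ) 2 := by
    by_contra h2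
    exact h (by simp [mkb', psi_deriv_supp h2])
  rw [mem_Icc, div_le_iff₀ (by positivity)] at h1
  apply abs_le_of_sq_le_sq _ (by positivity)
  have : 0 < l ^ 4 := by positivity
  nlinarith [h1.2]

/-- the cutoff adapted to a center and a scale -/
def mkCut (x0 : Spc n) (t0 : ℝ) (l : ℝ) (hl : 0 < l) : Cut n where
  a z := psi (‖z - x0‖ ^ 2 / l ^ 2)
  A := mkA x0 l
  b τ := psi ((τ - t0) ^ 2 / l ^ 4)
  b' := mkb' t0 l
  ha z := by
    have h1 : HasFDerivAt (fun z : Spc n => ‖z - x0‖ ^ 2) (2 • (innerSL ℝ (z - x0)).comp (ContinuousLinearMap.id ℝ (Spc n))) z :=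
      ((hasFDerivAt_id z).sub_const x0).norm_sq
    have h2 := (psi_hasDeriv (‖z - x0‖ ^ 2 / l ^ 2)).comp_hasFDerivAt z (h1.mul_const ((l ^ 2)⁻¹))
    refine HasFDerivAt.congr_fderiv (f := fun z : Spc n => psi (‖z - x0‖ ^ 2 / l ^ 2)) h2 ?_
    ext v
    simp [mkA, real_inner_smul_left]
    ring
  hb τ := by
    have h1 : HasDerivAt (fun τ : ℝ => (τ - t0) ^ 2 / l ^ 4) (2 * (τ - t0) / l ^ 4) τ := by
      refine ((((hasDerivAt_id τ).sub_const t0).pow 2).div_const (l ^ 4)).congr_deriv ?_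
      simp
    exact (psi_hasDeriv _).comp τ h1
  cA := by
    have := psi_deriv_cont
    unfold mkA; fun_prop
  cb' := by
    have := psi_deriv_cont
    unfold mkb'; fun_prop
  CA := 4 * C0 / l
  Cb := 4 * C0 / l ^ 2
  a_le z := psi_abs _
  b_le z := psi_abs _
  A_le z := by
    by_cases h : mkA x0 l z = 0
    · rw [h, norm_zero]; have := C0_nonneg; positivity
    · have := (mkA_supp hl h).2
      rw [mkA, norm_smul, norm_mul, Real.norm_eq_abs, Real.norm_eq_abs, abs_of_pos (a := 2 / l ^ 2) (by positivity)]
      calc _ ≤ C0 * (2 / l ^ 2) * (2 * l) := by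
            gcongr
            · have := C0_nonneg; positivity
            · exact psi_deriv_le _
        _ = _ := by field_simp; ring
  b'_le τ := by
    by_cases h : mkb' t0 l τ = 0
    · rw [h, abs_zero]; have := C0_nonneg; positivity
    · have := mkb'_supp hl h
      rw [mkb', abs_mul, abs_div, abs_mul, abs_of_pos (a := l ^ 4) (by positivity), abs_two]
      calc _ ≤ C0 * (2 * (2 * l ^ 2) / l ^ 4) := by
            gcongr
            · exact C0_nonneg
            · exact psi_deriv_le _
        _ = _ := by field_simp; ring
  T0 := t0 - 2 * l ^ 2
  T1 := t0 + 2 * l ^ 2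
  b_supp τ h := by
    apply psi_zero
    rw [le_div_iff₀ (by positivity)]
    have h1 : 2 * l ^ 2 ≤ |τ - t0| := by
      by_contra h2
      push Not at h2
      rw [abs_lt] at h2
      exact h ⟨by linarith, by linarith⟩
    have : 0 < l ^ 4 := by positivity
    nlinarith [sq_abs (τ - t0), mul_self_le_mul_self (by positivity) h1]
  b'_supp τ h := by
    by_contra h2
    have := abs_le.mp (mkb'_supp hl h2)
    exact h ⟨by linarith, by linarith⟩

lemma mkCut_one (x0 : Spc n) (t0 : ℝ) {l : ℝ} (hl : 0 < l) {s : ℝ} (hs : |s - t0| ≤ l ^ 2) :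
    (mkCut x0 t0 l hl).chi (x0, s) = 1 := by
  have h1 : psi ((s - t0) ^ 2 / l ^ 4) = 1 := by
    apply psi_one
    rw [div_le_one (by positivity)]
    calc (s - t0) ^ 2 = |s - t0| ^ 2 := (sq_abs _).symm
      _ ≤ (l ^ 2) ^ 2 := by gcongr
      _ = _ := by ring
  have h2 : psi (‖x0 - x0‖ ^ 2 / l ^ 2) = 1 := psi_one (by simp)
  simp only [Cut.chi, mkCut, h1, h2, mul_one]

lemma mkCut_supp (Q : PCube n) {p : Pt n} (hp : p ∈ Q.toSet) :
    {y | (mkCut p.1 p.2 Q.len Q.len_pos).chi y ≠ 0} ⊆ (Q.dilate 4 (by norm_num)).toSet := by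
  rintro ⟨y, u⟩ h
  have hl := Q.len_pos
  simp only [Cut.chi, mkCut, mem_setOf_eq, ne_eq, mul_eq_zero, not_or] at h
  have h1 : ‖y - p.1‖ ^ 2 < 2 * Q.len ^ 2 := by
    by_contra h2
    push Not at h2
    exact h.1 (psi_zero (by rwa [le_div_iff₀ (by positivity)]))
  have h2 : (u - p.2) ^ 2 < 2 * Q.len ^ 4 := by
    by_contra h2
    push Not at h2
    exact h.2 (psi_zero (by rwa [le_div_iff₀ (by positivity)]))
  have h3 : ∀ i, |y i - p.1 i| ≤ 3 / 2 * Q.len := by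
    intro i
    have := PiLp.norm_apply_le (y - p.1) i
    have h4 : ‖y - p.1‖ ≤ 3 / 2 * Q.len := by
      apply le_of_sq_le_sq _ (by positivity)
      nlinarith
    exact this.trans h4
  have h5 : |u - p.2| ≤ 2 * Q.len ^ 2 := by
    apply abs_le_of_sq_le_sq _ (by positivity)
    nlinarith
  refine ⟨fun i => ?_, ?_⟩
  · have := abs_le.mp (h3 i)
    have := hp.1 i
    simp only [PCube.dilate, mem_Icc] at this ⊢
    constructor <;> linarith
  · have := abs_le.mp h5
    have := hp.2
    simp only [PCube.dilate, mem_Icc] at this ⊢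
    constructor <;> nlinarith



lemma heatW_line_deriv (z e : Spc n) (s r : ℝ) :
    HasDerivAt (fun r : ℝ => heatW (z + r • e, s)) (inner ℝ (gradW (z + r • e, s)) e) r := by
  rcases le_or_gt s 0 with hs | hs
  · simp only [heatW_neg_eq _ hs, gradW_neg_eq _ hs, inner_zero_left]
    exact hasDerivAt_const _ _
  · have h1 : HasDerivAt (fun r : ℝ => z + r • e) e r := by
      simpa using ((hasDerivAt_id r).smul_const e).const_add z
    have h2 := h1.norm_sq
    have h3 := ((h2.neg.div_const (4 * s)).exp).const_mul ((4 * π * s) ^ (-(n : ℝ) / 2))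
    simp only [heatW_pos_eq _ hs, gradW_eq, real_inner_smul_left]
    refine h3.congr_deriv ?_
    simp only [Pi.neg_apply]
    ring

lemma gradW_line_cont (z e : Spc n) (s : ℝ) :
    Continuous (fun r : ℝ => (inner ℝ (gradW (z + r • e, s)) e : ℝ)) := by
  rcases le_or_gt s 0 with hs | hs
  · simp only [gradW_neg_eq _ hs]; fun_prop
  · simp only [gradW_eq, heatW_pos_eq _ hs]; fun_prop

lemma heatW_line (z e : Spc n) (s : ℝ) :
    ∫ r in Ioc (0:ℝ) 1, (inner ℝ (gradW (z + r • e, s)) e : ℝ) = heatW (z + e, s) - heatW (z, s) := by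
  rw [← intervalIntegral.integral_of_le zero_le_one,
    intervalIntegral.integral_eq_sub_of_hasDerivAt (fun r _ => heatW_line_deriv z e s r)
      ((gradW_line_cont z e s).intervalIntegrable _ _)]
  simp

lemma mconv_line (μ : Measure (Pt n)) [IsFiniteMeasure μ] (e : Spc n) :
    ∀ᵐ p : Pt n, Integrable (fun r : ℝ => (inner ℝ (mconvGradW μ (p + (r • e, 0))) e : ℝ)) (volume.restrict (Ioc (0:ℝ) 1)) ∧
      ∫ r in Ioc (0:ℝ) 1, (inner ℝ (mconvGradW μ (p + (r • e, 0))) e : ℝ) =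
        mconvW μ (p + (e, 0)) - mconvW μ p := by
  have t1 := tonelli (n := n) (μ.prod (volume.restrict (Ioc (0:ℝ) 1))) (fun yr => yr.1 - (yr.2 • e, 0)) (by fun_prop)
  have t2 := tonelli (n := n) μ (fun y => y - (e, 0)) (by fun_prop)
  filter_upwards [t1, t2, ae_goodM μ] with p h1 h2 h3
  have e1 : ∀ (y : Pt n) (v : Spc n), p - (y - (v, 0)) = p + (v, 0) - y := by intro y v; abel
  simp only [e1] at h1 h2
  have hi := h1.2
  have hi' : Integrable (fun yr : Pt n × ℝ => (inner ℝ (gradW (p + (yr.2 • e, 0) - yr.1)) e : ℝ)) (μ.prod (volume.restrict (Ioc (0:ℝ) 1))) := hi.inner_const e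
  have hae : (fun r : ℝ => ∫ y, (inner ℝ (gradW (p + (r • e, 0) - y)) e : ℝ) ∂μ) =ᵐ[volume.restrict (Ioc (0:ℝ) 1)]
      fun r => inner ℝ (mconvGradW μ (p + (r • e, 0))) e := by
    filter_upwards [hi.prod_left_ae] with r hr
    rw [mconvGradW, real_inner_comm, ← integral_inner hr]
    simp only [real_inner_comm]
  refine ⟨hi'.integral_prod_right.congr hae, ?_⟩
  rw [← integral_congr_ae hae, ← integral_integral_swap (f := fun y r => (inner ℝ (gradW (p + (r • e, 0) - y)) e : ℝ)) hi', mconvW, mconvW, ← integral_sub h2.1 h3.1]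
  congr 1 with y
  have := heatW_line (p.1 - y.1) e (p.2 - y.2)
  have e2 : ∀ v : Spc n, p + (v, 0) - y = (p.1 - y.1 + v, p.2 - y.2) := by
    intro v
    ext1
    · simp; abel
    · simp
  simp only [e2]
  rw [this]
  rfl

lemma conv_line (ν : SignedMeasure (Pt n)) (hν : ∀ p, ‖convGradW ν p‖ ≤ 1) (e : Spc n) :
    ∀ᵐ p : Pt n, |convW ν (p + (e, 0)) - convW ν p| ≤ ‖e‖ := by
  filter_upwards [mconv_line ν.toJordanDecomposition.posPart e, mconv_line ν.toJordanDecomposition.negPart e]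
    with p ⟨i1, h1⟩ ⟨i2, h2⟩
  have : convW ν (p + (e, 0)) - convW ν p = ∫ r in Ioc (0:ℝ) 1, (inner ℝ (convGradW ν (p + (r • e, 0))) e : ℝ) := by
    have a1 : ∀ q, convW ν q = mconvW ν.toJordanDecomposition.posPart q - mconvW ν.toJordanDecomposition.negPart q := fun q => rfl
    have a2 : ∀ q, convGradW ν q = mconvGradW ν.toJordanDecomposition.posPart q - mconvGradW ν.toJordanDecomposition.negPart q := fun q => rfl
    simp only [a1, a2, inner_sub_left]
    rw [integral_sub i1 i2, h1, h2]
    ring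
  rw [this]
  have := norm_integral_le_of_norm_le_const (μ := volume.restrict (Ioc (0:ℝ) 1)) (C := ‖e‖)
    (f := fun r => (inner ℝ (convGradW ν (p + (r • e, 0))) e : ℝ)) (Filter.Eventually.of_forall fun r => by
      refine (abs_real_inner_le_norm _ _).trans ?_
      exact mul_le_of_le_one_left (norm_nonneg _) (hν _))
  simpa using this

lemma measurable_mconvW (μ : Measure (Pt n)) [IsFiniteMeasure μ] : Measurable (mconvW μ) := by
  have hW := measurable_heatW (n := n)
  have : StronglyMeasurable (fun r : Pt n × Pt n => heatW (r.1 - r.2)) := by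
    apply Measurable.stronglyMeasurable; fun_prop
  exact this.integral_prod_right'.measurable

lemma measurable_convW (ν : SignedMeasure (Pt n)) : Measurable (convW ν) :=
  (measurable_mconvW _).sub (measurable_mconvW _)

lemma cont_of_lip {ν : SignedMeasure (Pt n)} (hL : LipHalfLe (convW ν) 1) (x : Spc n) :
    Continuous fun s => convW ν (x, s) := by
  rw [continuous_iff_continuousAt]
  intro t
  rw [ContinuousAt, tendsto_iff_norm_sub_tendsto_zero]
  refine squeeze_zero (fun _ => norm_nonneg _) (fun s => hL x s t) ?_
  have : Continuous fun s : ℝ => 1 * √|s - t| := by fun_prop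
  simpa using this.tendsto t

lemma conv_lip (ν : SignedMeasure (Pt n)) (hν : ∀ p, ‖convGradW ν p‖ ≤ 1) (hL : LipHalfLe (convW ν) 1) :
    ∀ᵐ x : Spc n, ∀ᵐ x' : Spc n, ∀ s : ℝ, |convW ν (x', s) - convW ν (x, s)| ≤ ‖x' - x‖ := by
  have hm := measurable_convW ν
  have h1 : ∀ᵐ e : Spc n, ∀ᵐ p : Pt n, |convW ν (p + (e, 0)) - convW ν p| ≤ ‖e‖ :=
    Filter.Eventually.of_forall fun e => conv_line ν hν e
  have h2 : ∀ᵐ p : Pt n, ∀ᵐ e : Spc n, |convW ν (p + (e, 0)) - convW ν p| ≤ ‖e‖ := by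
    rw [Measure.ae_ae_comm] at h1
    · exact h1
    · apply measurableSet_le <;> fun_prop
  rw [Measure.volume_eq_prod] at h2
  filter_upwards [Measure.ae_ae_of_ae_prod h2] with x hx
  have h3 : ∀ᵐ e : Spc n, ∀ᵐ s : ℝ, |convW ν ((x, s) + (e, 0)) - convW ν (x, s)| ≤ ‖e‖ := by
    rw [Measure.ae_ae_comm] at hx
    · exact hx
    · apply measurableSet_le <;> fun_prop
  have h4 : ∀ᵐ e : Spc n, ∀ s : ℝ, |convW ν (e + x, s) - convW ν (x, s)| ≤ ‖e‖ := by
    filter_upwards [h3] with e he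
    have hd := Measure.dense_of_ae he
    have hc : IsClosed {s : ℝ | |convW ν ((x, s) + (e, 0)) - convW ν (x, s)| ≤ ‖e‖} := by
      have c1 := cont_of_lip hL (x + e)
      have c2 := cont_of_lip hL x
      simp only [Prod.mk_add_mk, add_zero]
      exact isClosed_le (by fun_prop) (by fun_prop)
    intro s
    have : s ∈ {s : ℝ | |convW ν ((x, s) + (e, 0)) - convW ν (x, s)| ≤ ‖e‖} := by
      rw [← hc.closure_eq, hd.closure_eq]; trivial
    have h5 : |convW ν ((x, s) + (e, 0)) - convW ν (x, s)| ≤ ‖e‖ := this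
    simpa [add_comm] using h5
  have h6 := ((measurePreserving_sub_right (volume : Measure (Spc n)) x).quasiMeasurePreserving).ae h4
  filter_upwards [h6] with x' hx' s
  simpa using hx' s



lemma lint_sym {φ : ℝ → ENNReal} (hφ : Measurable φ) (a : ℝ) :
    ∫⁻ τ, (φ (τ - a) + φ (a - τ)) = 2 * ∫⁻ v, φ v := by
  rw [lintegral_add_left (by fun_prop), lintegral_sub_right_eq_self φ a, lintegral_sub_left_eq_self φ a, two_mul]

lemma lint_pow0 {L : ℝ} (hL : 0 ≤ L) :
    ∫⁻ v in Ioc 0 L, ENNReal.ofReal (v ^ (-(3/4) : ℝ)) = ENNReal.ofReal (4 * L ^ (1/4 : ℝ)) := by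
  have h1 : IntervalIntegrable (fun x : ℝ => x ^ (-(3/4) : ℝ)) volume 0 L :=
    intervalIntegral.intervalIntegrable_rpow' (by norm_num)
  have h2 := (intervalIntegrable_iff_integrableOn_Ioc_of_le hL).mp h1
  rw [← ofReal_integral_eq_lintegral_ofReal h2]
  · rw [← intervalIntegral.integral_of_le hL, integral_rpow (Or.inl (by norm_num))]
    congr 1
    have : (-(3/4) + 1 : ℝ) = 1/4 := by norm_num
    rw [this, Real.zero_rpow (by norm_num)]
    ring
  · filter_upwards [ae_restrict_mem measurableSet_Ioc] with v hv
    exact Real.rpow_nonneg hv.1.le _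

lemma lint_pow (a : ℝ) {L : ℝ} (hL : 0 ≤ L) :
    ∫⁻ τ in Icc (a - L) (a + L), ENNReal.ofReal (|τ - a| ^ (-(3/4) : ℝ)) ≤ ENNReal.ofReal (8 * L ^ (1/4 : ℝ)) := by
  have hφ : Measurable ((Ioc (0:ℝ) L).indicator fun v => ENNReal.ofReal (v ^ (-(3/4) : ℝ))) :=
    Measurable.indicator (by fun_prop) measurableSet_Ioc
  rw [← lintegral_indicator measurableSet_Icc]
  calc _ ≤ ∫⁻ τ, ((Ioc (0:ℝ) L).indicator (fun v => ENNReal.ofReal (v ^ (-(3/4) : ℝ))) (τ - a) +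
        (Ioc (0:ℝ) L).indicator (fun v => ENNReal.ofReal (v ^ (-(3/4) : ℝ))) (a - τ)) := by
        apply lintegral_mono
        intro τ
        simp only
        by_cases h : τ ∈ Icc (a - L) (a + L)
        · rw [indicator_of_mem h]
          rcases lt_trichotomy τ a with h1 | h1 | h1
          · rw [indicator_of_mem (a := a - τ) (by exact ⟨by linarith, by linarith [h.1]⟩)]
            rw [abs_of_neg (by linarith), neg_sub]
            exact le_add_self
          · rw [h1, sub_self, abs_zero, Real.zero_rpow (by norm_num)]; simp
          · rw [indicator_of_mem (a := τ - a) (by exact ⟨by linarith, by linarith [h.2]⟩)]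
            rw [abs_of_pos (by linarith)]
            exact le_self_add
        · rw [indicator_of_notMem h]; exact zero_le
    _ = 2 * ENNReal.ofReal (4 * L ^ (1/4 : ℝ)) := by
        rw [lint_sym hφ, lintegral_indicator measurableSet_Ioc, lint_pow0 hL]
    _ = _ := by
        rw [← ENNReal.ofReal_ofNat 2, ← ENNReal.ofReal_mul (by norm_num)]
        congr 1; ring

lemma lint_tail (a : ℝ) {L : ℝ} (hL : 0 < L) :
    ∫⁻ τ in {τ | L < |τ - a|}, ENNReal.ofReal (|τ - a| ^ (-(3/2) : ℝ)) ≤ ENNReal.ofReal (4 * L ^ (-(1/2) : ℝ)) := by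
  have hφ : Measurable ((Ioi L).indicator fun v => ENNReal.ofReal (v ^ (-(3/2) : ℝ))) :=
    Measurable.indicator (by fun_prop) measurableSet_Ioi
  have hS : MeasurableSet {τ : ℝ | L < |τ - a|} := measurableSet_lt measurable_const (by fun_prop)
  rw [← lintegral_indicator hS]
  have h0 : ∫⁻ v in Ioi L, ENNReal.ofReal (v ^ (-(3/2) : ℝ)) = ENNReal.ofReal (2 * L ^ (-(1/2) : ℝ)) := by
    rw [← ofReal_integral_eq_lintegral_ofReal (integrableOn_Ioi_rpow_of_lt (by norm_num) hL)]
    · rw [integral_Ioi_rpow_of_lt (by norm_num) hL]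
      congr 1
      have : (-(3/2) + 1 : ℝ) = -(1/2) := by norm_num
      rw [this]; ring
    · filter_upwards [ae_restrict_mem measurableSet_Ioi] with v hv
      exact Real.rpow_nonneg (hL.le.trans (le_of_lt hv)) _
  calc _ ≤ ∫⁻ τ, ((Ioi L).indicator (fun v => ENNReal.ofReal (v ^ (-(3/2) : ℝ))) (τ - a) +
        (Ioi L).indicator (fun v => ENNReal.ofReal (v ^ (-(3/2) : ℝ))) (a - τ)) := by
        apply lintegral_mono
        intro τ
        simp only
        by_cases h : L < |τ - a|
        · rw [indicator_of_mem (show τ ∈ {τ : ℝ | L < |τ - a|} from h)]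
          rcases lt_abs.mp h with h1 | h1
          · rw [indicator_of_mem (a := τ - a) (by exact h1), abs_of_pos (by linarith)]
            exact le_self_add
          · rw [indicator_of_mem (a := a - τ) (by show L < a - τ; linarith), abs_of_neg (by linarith), neg_sub]
            exact le_add_self
        · rw [indicator_of_notMem (show τ ∉ {τ : ℝ | L < |τ - a|} from h)]; exact zero_le
    _ = 2 * ENNReal.ofReal (2 * L ^ (-(1/2) : ℝ)) := by
        rw [lint_sym hφ, lintegral_indicator measurableSet_Ioi, h0]
    _ = _ := by
        rw [← ENNReal.ofReal_ofNat 2, ← ENNReal.ofReal_mul (by norm_num)]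
        congr 1; ring

/-- the kernel difference -/
def kk (x : Spc n) (s t : ℝ) (q : Pt n) : ℝ :=
  |heatW ((x, s) - q) - heatW ((x, t) - q)| + ‖x - q.1‖ * ‖gradW ((x, s) - q) - gradW ((x, t) - q)‖

lemma kk_nonneg (x : Spc n) (s t : ℝ) (q : Pt n) : 0 ≤ kk x s t q := by unfold kk; positivity

lemma kk_symm (x : Spc n) (s t : ℝ) (q : Pt n) : kk x s t q = kk x t s q := by
  unfold kk; rw [abs_sub_comm, norm_sub_rev (gradW _)]

lemma measurable_kk (x : Spc n) (s t : ℝ) : Measurable (kk x s t) := by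
  have hW := measurable_heatW (n := n)
  have hG := measurable_gradW (n := n)
  unfold kk; fun_prop

lemma lint_kk_aux (x : Spc n) {s t t0 l : ℝ} (hts : t < s) (h1 : |t - t0| ≤ l ^ 2) :
    ∫⁻ q in {q : Pt n | q.2 ∈ Icc (t0 - 2 * l ^ 2) (t0 + 2 * l ^ 2)}, ENNReal.ofReal (kk x s t q) ≤
      ENNReal.ofReal ((2 + M2 n) * (n + 1) * (s - t) ^ (3/4 : ℝ) * (8 * (3 * l ^ 2) ^ (1/4 : ℝ))) := by
  have hM := M2_nonneg (n := n)
  have hk := measurable_kk x s t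
  have e : {q : Pt n | q.2 ∈ Icc (t0 - 2 * l ^ 2) (t0 + 2 * l ^ 2)} = (univ : Set (Spc n)) ×ˢ Icc (t0 - 2 * l ^ 2) (t0 + 2 * l ^ 2) := by ext; simp
  rw [e, Measure.volume_eq_prod, ← Measure.prod_restrict, Measure.restrict_univ,
    lintegral_prod_symm _ (by apply Measurable.aemeasurable; fun_prop)]
  have h0 : 0 ≤ s - t := by linarith
  have hd : 0 ≤ (s - t) ^ (3/4 : ℝ) := Real.rpow_nonneg h0 _
  calc _ ≤ ∫⁻ τ in Icc (t0 - 2 * l ^ 2) (t0 + 2 * l ^ 2), ENNReal.ofReal ((2 + M2 n) * (n + 1) * (s - t) ^ (3/4 : ℝ)) *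
        ENNReal.ofReal (|τ - t| ^ (-(3/4) : ℝ)) := by
        apply lintegral_mono_ae
        have : ∀ᵐ τ : ℝ, τ ≠ t := by
          rw [ae_iff]; simp
        filter_upwards [ae_restrict_of_ae this] with τ hτ
        have := kernel_holder x (a := t - τ) (b := s - τ) (by linarith) (by intro h; apply hτ; linarith)
        simp only [kk, Prod.mk_sub_mk]
        refine this.trans (le_of_eq ?_)
        rw [← ENNReal.ofReal_mul (by positivity)]
        congr 1
        have e1 : s - τ - (t - τ) = s - t := by ring
        rw [e1, Real.div_rpow h0 (abs_nonneg _), abs_sub_comm t τ, Real.rpow_neg (abs_nonneg _)]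
        ring
    _ = ENNReal.ofReal ((2 + M2 n) * (n + 1) * (s - t) ^ (3/4 : ℝ)) * ∫⁻ τ in Icc (t0 - 2 * l ^ 2) (t0 + 2 * l ^ 2),
        ENNReal.ofReal (|τ - t| ^ (-(3/4) : ℝ)) := by
        rw [lintegral_const_mul _ (by fun_prop)]
    _ ≤ ENNReal.ofReal ((2 + M2 n) * (n + 1) * (s - t) ^ (3/4 : ℝ)) * ∫⁻ τ in Icc (t - 3 * l ^ 2) (t + 3 * l ^ 2),
        ENNReal.ofReal (|τ - t| ^ (-(3/4) : ℝ)) := by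
        refine mul_le_mul' le_rfl (lintegral_mono_set (Icc_subset_Icc ?_ ?_))
        · linarith [(abs_le.mp h1).1, (abs_le.mp h1).2]
        · linarith [(abs_le.mp h1).1, (abs_le.mp h1).2]
    _ ≤ ENNReal.ofReal ((2 + M2 n) * (n + 1) * (s - t) ^ (3/4 : ℝ)) * ENNReal.ofReal (8 * (3 * l ^ 2) ^ (1/4 : ℝ)) := by
        gcongr
        exact lint_pow t (by positivity)
    _ = _ := by
        rw [← ENNReal.ofReal_mul (by positivity)]

lemma lint_kk (x : Spc n) {s t l : ℝ} (h1 : |s - t| ≤ l ^ 2) :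
    ∫⁻ q in {q : Pt n | q.2 ∈ Icc (t - 2 * l ^ 2) (t + 2 * l ^ 2)}, ENNReal.ofReal (kk x s t q) ≤
      ENNReal.ofReal ((2 + M2 n) * (n + 1) * |s - t| ^ (3/4 : ℝ) * (8 * (3 * l ^ 2) ^ (1/4 : ℝ))) := by
  rcases lt_trichotomy s t with h | h | h
  · rw [abs_of_neg (by linarith), neg_sub]
    simp_rw [kk_symm x s t]
    exact lint_kk_aux x h h1
  · subst h
    simp [kk]
  · rw [abs_of_pos (by linarith)]
    exact lint_kk_aux x h (by simp; positivity)

/-- Hölder constant -/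
def CH (n : ℕ) : ℝ := 320 * C0 * ((2 + M2 n) * (n + 1))

lemma CH_nonneg : 0 ≤ CH n := by
  have := M2_nonneg (n := n); have := C0_nonneg
  unfold CH; positivity

lemma R_diff (ν : SignedMeasure (Pt n)) (hν : ∀ p, ‖convGradW ν p‖ ≤ 1) (hL : LipHalfLe (convW ν) 1)
    {x : Spc n} {s t l : ℝ} (hl : 0 < l) (q : Pt n)
    (hx : ∀ s : ℝ, |convW ν (q.1, s) - convW ν (x, s)| ≤ ‖q.1 - x‖) :
    ‖(mkCut x t l hl).R (fun q => convW ν q - convW ν (x, t)) (convGradW ν) (x, s) q -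
      (mkCut x t l hl).R (fun q => convW ν q - convW ν (x, t)) (convGradW ν) (x, t) q‖ₑ ≤
    {q : Pt n | q.2 ∈ Icc (t - 2 * l ^ 2) (t + 2 * l ^ 2)}.indicator
      (fun q => ENNReal.ofReal (20 * C0 / l) * ENNReal.ofReal (kk x s t q)) q := by
  set c := mkCut x t l hl with hc
  have hC := C0_nonneg
  by_cases hq : q.2 ∈ Icc c.T0 c.T1
  swap
  · simp [Cut.R, c.chit_supp hq, c.X_supp hq]
  rw [indicator_of_mem (show q ∈ {q : Pt n | q.2 ∈ Icc (t - 2 * l ^ 2) (t + 2 * l ^ 2)} from hq), ← ofReal_norm,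
    ← ENNReal.ofReal_mul (by positivity)]
  apply ENNReal.ofReal_le_ofReal
  set F := convW ν q - convW ν (x, t) with hF
  have hFle : ‖q.1 - x‖ ≤ 2 * l → |F| ≤ 4 * l := by
    intro h
    have h1 := hx q.2
    have h2 := hL x q.2 t
    have h3 : √|q.2 - t| ≤ 2 * l := by
      rw [Real.sqrt_le_left (by positivity)]
      have : |q.2 - t| ≤ 2 * l ^ 2 := abs_le.mpr ⟨by linarith [hq.1, show c.T0 = t - 2 * l ^ 2 from rfl], by linarith [hq.2, show c.T1 = t + 2 * l ^ 2 from rfl]⟩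
      nlinarith
    have : F = (convW ν (q.1, q.2) - convW ν (x, q.2)) + (convW ν (x, q.2) - convW ν (x, t)) := by
      simp only [hF]; ring
    rw [this]
    refine (abs_add_le _ _).trans ?_
    linarith
  set w := heatW ((x, s) - q) - heatW ((x, t) - q) with hw
  set g := gradW ((x, s) - q) - gradW ((x, t) - q) with hg
  have e : c.R (fun q => convW ν q - convW ν (x, t)) (convGradW ν) (x, s) q -
      c.R (fun q => convW ν q - convW ν (x, t)) (convGradW ν) (x, t) q =
      w * (c.chit q * F) - w * inner ℝ (c.X q) (convGradW ν q) - inner ℝ (c.X q) g * F := by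
    simp only [Cut.R, hw, hg, inner_sub_right, ← hF]
    ring
  rw [e, Real.norm_eq_abs]
  have b1 : |c.chit q * F| ≤ 16 * C0 / l := by
    by_cases h : ‖q.1 - x‖ ≤ 2 * l
    · rw [abs_mul]
      calc _ ≤ (4 * C0 / l ^ 2) * (4 * l) := mul_le_mul (c.chit_le q) (hFle h) (abs_nonneg _) (by positivity)
        _ = _ := by field_simp; ring
    · have : c.a q.1 = 0 := by
        apply psi_zero
        rw [le_div_iff₀ (by positivity)]
        push Not at h
        nlinarith
      rw [Cut.chit, this]
      simp; positivity
  have b2 : |(inner ℝ (c.X q) (convGradW ν q) : ℝ)| ≤ 4 * C0 / l := by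
    refine (abs_real_inner_le_norm _ _).trans ?_
    calc _ ≤ (4 * C0 / l) * 1 := mul_le_mul (c.X_le q) (hν q) (norm_nonneg _) (by positivity)
      _ = _ := mul_one _
  have b3 : |inner ℝ (c.X q) g * F| ≤ 16 * C0 / l * (‖x - q.1‖ * ‖g‖) := by
    by_cases h : mkA x l q.1 = 0
    · have : c.X q = 0 := by
        rw [Cut.X]
        have : c.A q.1 = 0 := h
        rw [this, smul_zero]
      rw [this]; simp; positivity
    · obtain ⟨h1, h2⟩ := mkA_supp hl h
      rw [norm_sub_rev] at h1
      rw [abs_mul]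
      calc _ ≤ (‖c.X q‖ * ‖g‖) * (4 * l) := mul_le_mul (abs_real_inner_le_norm _ _) (hFle h2) (abs_nonneg _) (by positivity)
        _ ≤ (4 * C0 / l * ‖g‖) * (4 * ‖x - q.1‖) := by
            gcongr
            exact c.X_le q
        _ = _ := by ring
  calc _ ≤ |w * (c.chit q * F)| + |w * inner ℝ (c.X q) (convGradW ν q)| + |inner ℝ (c.X q) g * F| := by
        refine (abs_sub _ _).trans ?_
        gcongr
        exact abs_sub _ _
    _ ≤ |w| * (16 * C0 / l) + |w| * (4 * C0 / l) + 16 * C0 / l * (‖x - q.1‖ * ‖g‖) := by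
        rw [abs_mul w, abs_mul w]
        gcongr
    _ ≤ |w| * (16 * C0 / l) + |w| * (4 * C0 / l) + 20 * C0 / l * (‖x - q.1‖ * ‖g‖) := by
        gcongr
        norm_num
    _ = _ := by rw [kk]; ring

lemma near_num {l d : ℝ} (hl : 0 < l) (hd : 0 ≤ d) :
    20 * C0 / l * ((2 + M2 n) * (n + 1) * d * (8 * (3 * l ^ 2) ^ (1/4 : ℝ))) ≤ CH n * d / √l := by
  have hM := M2_nonneg (n := n)
  have hC := C0_nonneg
  have h3 : (3 * l ^ 2) ^ (1/4 : ℝ) ≤ 2 * √l := by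
    have : (3 * l ^ 2) ≤ (2 * √l) ^ (4 : ℝ) := by
      rw [show (4:ℝ) = ((4:ℕ):ℝ) by norm_num, Real.rpow_natCast]
      have : √l ^ 4 = l ^ 2 := by
        calc √l ^ 4 = (√l ^ 2) ^ 2 := by ring
          _ = _ := by rw [Real.sq_sqrt hl.le]
      rw [mul_pow, this]; nlinarith [sq_nonneg l]
    calc _ ≤ ((2 * √l) ^ (4 : ℝ)) ^ (1/4 : ℝ) := by gcongr
      _ = _ := by rw [← Real.rpow_mul (by positivity)]; norm_num
  calc _ ≤ 20 * C0 / l * ((2 + M2 n) * (n + 1) * d * (8 * (2 * √l))) := by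
        gcongr
    _ = CH n * d * (√l / l) := by rw [CH]; ring
    _ = _ := by
        rw [Real.sqrt_div_self', mul_one_div]

lemma near_rep (ν : SignedMeasure (Pt n)) {x : Spc n} {s t l : ℝ} (hl : 0 < l)
    (hsupp : ν.totalVariation {y | (mkCut x t l hl).chi y ≠ 0} = 0)
    (ht : Good ν (x, t)) (hs : Good ν (x, s)) (hst : |s - t| ≤ l ^ 2) :
    convW ν (x, s) - convW ν (x, t) = ∫ q, ((mkCut x t l hl).R (fun q => convW ν q - convW ν (x, t)) (convGradW ν) (x, s) q -
      (mkCut x t l hl).R (fun q => convW ν q - convW ν (x, t)) (convGradW ν) (x, t) q) := by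
  obtain ⟨i1, e1⟩ := (mkCut x t l hl).rep_signed ν hsupp (convW ν (x, t)) (x, s) hs
  obtain ⟨i2, e2⟩ := (mkCut x t l hl).rep_signed ν hsupp (convW ν (x, t)) (x, t) ht
  rw [mkCut_one x t hl hst, one_mul] at e1
  rw [sub_self, mul_zero] at e2
  rw [integral_sub i1 i2, ← e2, sub_zero]; exact e1

lemma near_lint (ν : SignedMeasure (Pt n)) (hν : ∀ p, ‖convGradW ν p‖ ≤ 1) (hL : LipHalfLe (convW ν) 1)
    {x : Spc n} {s t l : ℝ} (hl : 0 < l)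
    (hx : ∀ᵐ x' : Spc n, ∀ s : ℝ, |convW ν (x', s) - convW ν (x, s)| ≤ ‖x' - x‖)
    (hst : |s - t| ≤ l ^ 2) :
    ∫⁻ q, ‖(mkCut x t l hl).R (fun q => convW ν q - convW ν (x, t)) (convGradW ν) (x, s) q -
      (mkCut x t l hl).R (fun q => convW ν q - convW ν (x, t)) (convGradW ν) (x, t) q‖ₑ ≤
      ENNReal.ofReal (CH n * |s - t| ^ (3/4 : ℝ) / √l) := by
  have hC := C0_nonneg
  have hae : ∀ᵐ q : Pt n, ∀ s : ℝ, |convW ν (q.1, s) - convW ν (x, s)| ≤ ‖q.1 - x‖ := by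
    rw [Measure.volume_eq_prod]
    exact Measure.quasiMeasurePreserving_fst.ae hx
  have hmS : MeasurableSet {q : Pt n | q.2 ∈ Icc (t - 2 * l ^ 2) (t + 2 * l ^ 2)} := measurable_snd measurableSet_Icc
  have hk := measurable_kk x s t
  calc _ ≤ ∫⁻ q, {q : Pt n | q.2 ∈ Icc (t - 2 * l ^ 2) (t + 2 * l ^ 2)}.indicator
        (fun q => ENNReal.ofReal (20 * C0 / l) * ENNReal.ofReal (kk x s t q)) q := by
        apply lintegral_mono_ae
        filter_upwards [hae] with q hq using R_diff ν hν hL hl q hq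
    _ = ENNReal.ofReal (20 * C0 / l) * ∫⁻ q in {q : Pt n | q.2 ∈ Icc (t - 2 * l ^ 2) (t + 2 * l ^ 2)}, ENNReal.ofReal (kk x s t q) := by
        rw [lintegral_indicator hmS, lintegral_const_mul _ hk.ennreal_ofReal]
    _ ≤ ENNReal.ofReal (20 * C0 / l) * ENNReal.ofReal ((2 + M2 n) * (n + 1) * |s - t| ^ (3/4 : ℝ) * (8 * (3 * l ^ 2) ^ (1/4 : ℝ))) :=
        mul_le_mul' le_rfl (lint_kk x hst)
    _ ≤ _ := by
        rw [← ENNReal.ofReal_mul (by positivity)]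
        exact ENNReal.ofReal_le_ofReal (near_num hl (Real.rpow_nonneg (abs_nonneg _) _))

lemma near_holder (Q : PCube n) (ν : SignedMeasure (Pt n))
    (h4 : ν.totalVariation ((Q.dilate 4 (by norm_num)).toSet) = 0)
    (hν : ∀ p, ‖convGradW ν p‖ ≤ 1) (hL : LipHalfLe (convW ν) 1)
    {x : Spc n} {s t : ℝ} (hp : (x, t) ∈ Q.toSet)
    (hx : ∀ᵐ x' : Spc n, ∀ s : ℝ, |convW ν (x', s) - convW ν (x, s)| ≤ ‖x' - x‖)
    (ht : Good ν (x, t)) (hs : Good ν (x, s)) (hst : |s - t| ≤ Q.len ^ 2) :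
    |convW ν (x, s) - convW ν (x, t)| ≤ CH n * |s - t| ^ (3/4 : ℝ) / √Q.len := by
  have hl := Q.len_pos
  have e3 := near_rep ν hl (measure_mono_null (mkCut_supp Q hp) h4) ht hs hst
  have key : ‖convW ν (x, s) - convW ν (x, t)‖ₑ ≤ ENNReal.ofReal (CH n * |s - t| ^ (3/4 : ℝ) / √Q.len) := by
    rw [e3]
    exact (enorm_integral_le_lintegral_enorm _).trans (near_lint ν hν hL hl hx hst)
  have hC := CH_nonneg (n := n)
  have hd : 0 ≤ |s - t| ^ (3/4 : ℝ) := Real.rpow_nonneg (abs_nonneg _) _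
  rw [← ofReal_norm, ENNReal.ofReal_le_ofReal_iff (by positivity)] at key
  exact key


lemma rpow32 {a : ℝ} (ha : 0 ≤ a) : a ^ (3/2 : ℝ) = √a ^ 3 := by
  rw [Real.sqrt_eq_rpow, ← Real.rpow_natCast, ← Real.rpow_mul ha]; norm_num

/-- difference quotient -/
def NN (F : ℝ → ℝ) (t s : ℝ) : ℝ := (F s - F t) / |s - t| ^ (3/2 : ℝ)

lemma near_pt {F : ℝ → ℝ} {t s l C1 : ℝ} (hl : 0 < l) (hC : 0 ≤ C1)
    (hF : ∀ s u, |F s - F u| ≤ √|s - u|)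
    (hN : |s - t| ≤ l ^ 2 → |F s - F t| ≤ C1 * |s - t| ^ (3/4 : ℝ) / √l) :
    |NN F t s| ≤ C1 / √l * |s - t| ^ (-(3/4) : ℝ) + 1 / l ^ 2 := by
  have h0 : 0 ≤ |s - t| ^ (-(3/4) : ℝ) := Real.rpow_nonneg (abs_nonneg _) _
  rcases eq_or_ne s t with rfl | hne
  · simp only [NN, sub_self, zero_div, abs_zero]
    have : 0 ≤ |(0:ℝ)| ^ (-(3/4) : ℝ) := Real.rpow_nonneg (abs_nonneg _) _
    rw [abs_zero] at this
    positivity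
  have hp : 0 < |s - t| := abs_pos.mpr (sub_ne_zero.mpr hne)
  have h32 : 0 < |s - t| ^ (3/2 : ℝ) := Real.rpow_pos_of_pos hp _
  rw [NN, abs_div, abs_of_pos h32, div_le_iff₀ h32]
  by_cases h : |s - t| ≤ l ^ 2
  · have e : |s - t| ^ (-(3/4) : ℝ) * |s - t| ^ (3/2 : ℝ) = |s - t| ^ (3/4 : ℝ) := by
      rw [← Real.rpow_add hp]; norm_num
    calc _ ≤ _ := hN h
      _ = C1 / √l * (|s - t| ^ (-(3/4) : ℝ) * |s - t| ^ (3/2 : ℝ)) := by rw [e]; ring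
      _ ≤ C1 / √l * (|s - t| ^ (-(3/4) : ℝ) * |s - t| ^ (3/2 : ℝ)) + 1 / l ^ 2 * |s - t| ^ (3/2 : ℝ) := by
          have : 0 ≤ 1 / l ^ 2 * |s - t| ^ (3/2 : ℝ) := by positivity
          linarith
      _ = _ := by ring
  · push Not at h
    have h1 : √|s - t| ≤ 1 / l ^ 2 * |s - t| ^ (3/2 : ℝ) := by
      rw [rpow32 (abs_nonneg _)]
      have : √|s - t| ^ 3 = |s - t| * √|s - t| := by
        rw [pow_succ, Real.sq_sqrt (abs_nonneg _)]
      rw [this, ← mul_assoc]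
      have : 1 ≤ 1 / l ^ 2 * |s - t| := by
        rw [one_div, inv_mul_eq_div, one_le_div (by positivity)]; exact h.le
      nlinarith [Real.sqrt_nonneg |s - t|]
    calc _ ≤ _ := hF s t
      _ ≤ _ := h1
      _ ≤ _ := by
        rw [add_mul]
        have : 0 ≤ C1 / √l * |s - t| ^ (-(3/4) : ℝ) * |s - t| ^ (3/2 : ℝ) := by positivity
        linarith

lemma near_int {F : ℝ → ℝ} {t l C1 : ℝ} (hl : 0 < l) (hC : 0 ≤ C1)
    (hF : ∀ s u, |F s - F u| ≤ √|s - u|)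
    (hN : ∀ᵐ s, |s - t| ≤ l ^ 2 → |F s - F t| ≤ C1 * |s - t| ^ (3/4 : ℝ) / √l) :
    ∫⁻ s in Icc (t - 4 * l ^ 2) (t + 4 * l ^ 2), ‖NN F t s‖ₑ ≤ ENNReal.ofReal (16 * C1 + 8) := by
  have hsl := Real.sqrt_pos.mpr hl
  calc _ ≤ ∫⁻ s in Icc (t - 4 * l ^ 2) (t + 4 * l ^ 2),
        (ENNReal.ofReal (C1 / √l) * ENNReal.ofReal (|s - t| ^ (-(3/4) : ℝ)) + ENNReal.ofReal (1 / l ^ 2)) := by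
        apply lintegral_mono_ae
        filter_upwards [ae_restrict_of_ae hN] with s hs
        have := near_pt hl hC hF hs
        rw [← ENNReal.ofReal_mul (by positivity), ← ENNReal.ofReal_add
          (mul_nonneg (by positivity) (Real.rpow_nonneg (abs_nonneg _) _)) (by positivity), ← ofReal_norm]
        exact ENNReal.ofReal_le_ofReal this
    _ = ENNReal.ofReal (C1 / √l) * (∫⁻ s in Icc (t - 4 * l ^ 2) (t + 4 * l ^ 2), ENNReal.ofReal (|s - t| ^ (-(3/4) : ℝ))) +
        ENNReal.ofReal (1 / l ^ 2) * volume (Icc (t - 4 * l ^ 2) (t + 4 * l ^ 2)) := by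
        rw [lintegral_add_right _ measurable_const, lintegral_const_mul _ (by fun_prop), setLIntegral_const]
    _ ≤ ENNReal.ofReal (C1 / √l) * ENNReal.ofReal (8 * (4 * l ^ 2) ^ (1/4 : ℝ)) +
        ENNReal.ofReal (1 / l ^ 2) * ENNReal.ofReal (8 * l ^ 2) := by
        refine add_le_add (mul_le_mul' le_rfl (lint_pow t (by positivity))) (mul_le_mul' le_rfl ?_)
        rw [Real.volume_Icc]; apply ENNReal.ofReal_le_ofReal; linarith
    _ ≤ _ := by
        have h0 : 0 ≤ (4 * l ^ 2) ^ (1/4 : ℝ) := Real.rpow_nonneg (by positivity) _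
        rw [← ENNReal.ofReal_mul (by positivity), ← ENNReal.ofReal_mul (by positivity),
          ← ENNReal.ofReal_add (by positivity) (by positivity)]
        apply ENNReal.ofReal_le_ofReal
        have h3 : (4 * l ^ 2) ^ (1/4 : ℝ) ≤ 2 * √l := by
          have : (4 * l ^ 2) ≤ (2 * √l) ^ (4 : ℝ) := by
            rw [show (4:ℝ) = ((4:ℕ):ℝ) by norm_num, Real.rpow_natCast]
            have : √l ^ 4 = l ^ 2 := by
              calc √l ^ 4 = (√l ^ 2) ^ 2 := by ring
                _ = _ := by rw [Real.sq_sqrt hl.le]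
            rw [mul_pow, this]; push_cast; nlinarith [sq_nonneg l]
          calc _ ≤ ((2 * √l) ^ (4 : ℝ)) ^ (1/4 : ℝ) := by gcongr
            _ = _ := by rw [← Real.rpow_mul (by positivity)]; norm_num
        calc _ ≤ C1 / √l * (8 * (2 * √l)) + 1 / l ^ 2 * (8 * l ^ 2) := by gcongr
          _ = _ := by field_simp; ring

lemma far_alg {a b l : ℝ} (hl : 0 < l) (ha : 0 ≤ a) (hb : 0 ≤ b) (h1 : 3 * l ^ 2 < a ^ 2)
    (h2 : |a ^ 2 - b ^ 2| ≤ l ^ 2) : b * |1 / a ^ 3 - 1 / b ^ 3| ≤ 12 * l / a ^ 3 := by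
  obtain ⟨h3, h4⟩ := abs_le.mp h2
  have hal : l ≤ a := by nlinarith
  have ha' : 0 < a := by linarith
  have hb2 : 2 * a ^ 2 ≤ 3 * b ^ 2 := by nlinarith
  have hb' : 0 < b := by
    rcases hb.eq_or_lt with h | h
    · subst h; nlinarith
    · exact h
  have hb3 : b ≤ 2 * a := by nlinarith
  have h5 : |b - a| ≤ l := by
    have : |b - a| * (a + b) ≤ l ^ 2 := by
      rw [← abs_of_nonneg (add_nonneg ha hb), ← abs_mul,
        show (b - a) * (a + b) = b ^ 2 - a ^ 2 by ring, abs_sub_comm]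
      exact h2
    nlinarith [abs_nonneg (b - a)]
  have e : 1 / a ^ 3 - 1 / b ^ 3 = (b - a) * (a ^ 2 + a * b + b ^ 2) / (a ^ 3 * b ^ 3) := by
    field_simp; ring
  rw [e, abs_div, abs_mul, abs_of_pos (show 0 < a ^ 2 + a * b + b ^ 2 by positivity),
    abs_of_pos (show 0 < a ^ 3 * b ^ 3 by positivity)]
  have e2 : b * (|b - a| * (a ^ 2 + a * b + b ^ 2) / (a ^ 3 * b ^ 3)) = (|b - a| * ((a ^ 2 + a * b + b ^ 2) / b ^ 2)) / a ^ 3 := by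
    field_simp
  rw [e2]
  have h6 : (a ^ 2 + a * b + b ^ 2) / b ^ 2 ≤ 12 := by
    rw [div_le_iff₀ (by positivity)]
    nlinarith [sq_nonneg (a - b)]
  have h7 : |b - a| * ((a ^ 2 + a * b + b ^ 2) / b ^ 2) ≤ l * 12 :=
    mul_le_mul h5 h6 (by positivity) hl.le
  exact div_le_div_of_nonneg_right (by linarith) (by positivity)

lemma far_pt {F F0 : ℝ → ℝ} {t t0 s l K : ℝ} (hl : 0 < l) (ht : |t - t0| ≤ l ^ 2)
    (hF0 : ∀ s u, |F0 s - F0 u| ≤ √|s - u|)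
    (hFF : ∀ s, |F s - F0 s| ≤ K * l) (hs : 3 * l ^ 2 < |s - t|) :
    |NN F t s - NN F0 t0 s| ≤ (2 * K + 13) * l * |s - t| ^ (-(3/2) : ℝ) := by
  rw [Real.rpow_neg (abs_nonneg _), NN, NN, rpow32 (abs_nonneg _), rpow32 (abs_nonneg _)]
  set a := √|s - t| with ha
  set b := √|s - t0| with hb
  have ha2 : a ^ 2 = |s - t| := Real.sq_sqrt (abs_nonneg _)
  have hb2 : b ^ 2 = |s - t0| := Real.sq_sqrt (abs_nonneg _)
  have hd : |a ^ 2 - b ^ 2| ≤ l ^ 2 := by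
    rw [ha2, hb2]
    refine (abs_abs_sub_abs_le_abs_sub _ _).trans ?_
    rw [show s - t - (s - t0) = -(t - t0) by ring, abs_neg]; exact ht
  have ha0 : 0 ≤ a := Real.sqrt_nonneg _
  have hb0 : 0 ≤ b := Real.sqrt_nonneg _
  have key := far_alg hl ha0 hb0 (by rw [ha2]; exact hs) hd
  have e : (F s - F t) / a ^ 3 - (F0 s - F0 t0) / b ^ 3 =
      ((F s - F0 s) - (F t - F0 t) - (F0 t - F0 t0)) / a ^ 3 + (F0 s - F0 t0) * (1 / a ^ 3 - 1 / b ^ 3) := by ring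
  have h1 : |F0 t - F0 t0| ≤ l := by
    refine (hF0 t t0).trans ?_
    rw [Real.sqrt_le_left hl.le]; exact ht
  have h2 : |(F s - F0 s) - (F t - F0 t) - (F0 t - F0 t0)| ≤ (2 * K + 1) * l := by
    refine (abs_sub _ _).trans ?_
    have := (abs_sub (F s - F0 s) (F t - F0 t))
    linarith [hFF s, hFF t]
  have ha3 : 0 ≤ a ^ 3 := by positivity
  rw [e]
  refine (abs_add_le _ _).trans ?_
  rw [abs_div, abs_mul, abs_of_nonneg ha3]
  calc _ ≤ (2 * K + 1) * l / a ^ 3 + b * |1 / a ^ 3 - 1 / b ^ 3| := by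
        gcongr
        exact hF0 s t0
    _ ≤ (2 * K + 1) * l / a ^ 3 + 12 * l / a ^ 3 := by gcongr
    _ = _ := by ring

lemma oneD {F F0 : ℝ → ℝ} {t t0 l K C1 : ℝ} (hl : 0 < l) (hC : 0 ≤ C1) (hK : 0 ≤ K) (ht : |t - t0| ≤ l ^ 2)
    (hF : ∀ s u, |F s - F u| ≤ √|s - u|)
    (hF0 : ∀ s u, |F0 s - F0 u| ≤ √|s - u|)
    (hm : Measurable F)
    (hFF : ∀ s, |F s - F0 s| ≤ K * l)
    (hN : ∀ᵐ s, |s - t| ≤ l ^ 2 → |F s - F t| ≤ C1 * |s - t| ^ (3/4 : ℝ) / √l)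
    (hN0 : ∀ᵐ s, |s - t0| ≤ l ^ 2 → |F0 s - F0 t0| ≤ C1 * |s - t0| ^ (3/4 : ℝ) / √l) :
    ∫⁻ s, ‖NN F t s - NN F0 t0 s‖ₑ ≤ ENNReal.ofReal (2 * (16 * C1 + 8) + 4 * (2 * K + 13)) := by
  obtain ⟨ht1, ht2⟩ := abs_le.mp ht
  have hS : {s : ℝ | 3 * l ^ 2 < |s - t|}ᶜ ⊆ Icc (t - 4 * l ^ 2) (t + 4 * l ^ 2) := by
    intro s hs
    simp only [mem_compl_iff, mem_ofPred_eq, not_lt] at hs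
    obtain ⟨a, b⟩ := abs_le.mp hs
    constructor <;> nlinarith
  have hS0 : {s : ℝ | 3 * l ^ 2 < |s - t|}ᶜ ⊆ Icc (t0 - 4 * l ^ 2) (t0 + 4 * l ^ 2) := by
    intro s hs
    simp only [mem_compl_iff, mem_ofPred_eq, not_lt] at hs
    obtain ⟨a, b⟩ := abs_le.mp hs
    constructor <;> nlinarith
  have hmS : MeasurableSet {s : ℝ | 3 * l ^ 2 < |s - t|} := measurableSet_lt (by fun_prop) (by fun_prop)
  rw [← lintegral_add_compl _ hmS, add_comm, ENNReal.ofReal_add (by positivity) (by positivity)]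
  refine add_le_add ?_ ?_
  · calc _ ≤ ∫⁻ s in {s : ℝ | 3 * l ^ 2 < |s - t|}ᶜ, (‖NN F t s‖ₑ + ‖NN F0 t0 s‖ₑ) := by
          apply lintegral_mono
          intro s
          exact enorm_sub_le
      _ = (∫⁻ s in {s : ℝ | 3 * l ^ 2 < |s - t|}ᶜ, ‖NN F t s‖ₑ) + ∫⁻ s in {s : ℝ | 3 * l ^ 2 < |s - t|}ᶜ, ‖NN F0 t0 s‖ₑ := by
          apply lintegral_add_left
          unfold NN; fun_prop
      _ ≤ ENNReal.ofReal (16 * C1 + 8) + ENNReal.ofReal (16 * C1 + 8) :=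
          add_le_add ((lintegral_mono_set hS).trans (near_int hl hC hF hN))
            ((lintegral_mono_set hS0).trans (near_int hl hC hF0 hN0))
      _ = _ := by rw [← ENNReal.ofReal_add (by positivity) (by positivity)]; congr 1; ring
  · calc _ ≤ ∫⁻ s in {s : ℝ | 3 * l ^ 2 < |s - t|}, ENNReal.ofReal ((2 * K + 13) * l) * ENNReal.ofReal (|s - t| ^ (-(3/2) : ℝ)) := by
          apply setLIntegral_mono' hmS
          intro s hs
          rw [← ENNReal.ofReal_mul (by positivity), ← ofReal_norm]
          exact ENNReal.ofReal_le_ofReal (far_pt hl ht hF0 hFF hs)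
      _ = ENNReal.ofReal ((2 * K + 13) * l) * ∫⁻ s in {s : ℝ | 3 * l ^ 2 < |s - t|}, ENNReal.ofReal (|s - t| ^ (-(3/2) : ℝ)) := by
          rw [lintegral_const_mul _ (by fun_prop)]
      _ ≤ ENNReal.ofReal ((2 * K + 13) * l) * ENNReal.ofReal (4 * (3 * l ^ 2) ^ (-(1/2) : ℝ)) :=
          mul_le_mul' le_rfl (lint_tail t (by positivity))
      _ ≤ _ := by
          rw [← ENNReal.ofReal_mul (by positivity)]
          apply ENNReal.ofReal_le_ofReal
          have : (3 * l ^ 2) ^ (-(1/2) : ℝ) ≤ l⁻¹ := by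
            rw [Real.rpow_neg (by positivity), ← Real.sqrt_eq_rpow]
            gcongr
            apply Real.le_sqrt_of_sq_le
            nlinarith [sq_nonneg l]
          calc _ ≤ (2 * K + 13) * l * (4 * l⁻¹) := by gcongr
            _ = _ := by field_simp

lemma oneD_int {F F0 : ℝ → ℝ} {t t0 l K C1 : ℝ} (hl : 0 < l) (hC : 0 ≤ C1) (hK : 0 ≤ K) (ht : |t - t0| ≤ l ^ 2)
    (hF : ∀ s u, |F s - F u| ≤ √|s - u|)
    (hF0 : ∀ s u, |F0 s - F0 u| ≤ √|s - u|)
    (hm : Measurable F) (hm0 : Measurable F0)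
    (hFF : ∀ s, |F s - F0 s| ≤ K * l)
    (hN : ∀ᵐ s, |s - t| ≤ l ^ 2 → |F s - F t| ≤ C1 * |s - t| ^ (3/4 : ℝ) / √l)
    (hN0 : ∀ᵐ s, |s - t0| ≤ l ^ 2 → |F0 s - F0 t0| ≤ C1 * |s - t0| ^ (3/4 : ℝ) / √l) :
    |(∫ s, NN F t s) - ∫ s, NN F0 t0 s| ≤ 2 * (16 * C1 + 8) + 4 * (2 * K + 13) := by
  have h := oneD hl hC hK ht hF hF0 hm hFF hN hN0
  have hpos : 0 ≤ 2 * (16 * C1 + 8) + 4 * (2 * K + 13) := by positivity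
  have hM : Measurable (NN F t) := by unfold NN; fun_prop
  have hM0 : Measurable (NN F0 t0) := by unfold NN; fun_prop
  have hD : Integrable (fun s => NN F t s - NN F0 t0 s) :=
    ⟨(hM.sub hM0).aestronglyMeasurable, h.trans_lt ENNReal.ofReal_lt_top⟩
  by_cases hi : Integrable (NN F t)
  · have hi0 : Integrable (NN F0 t0) := by
      have := hi.sub hD
      refine this.congr (Filter.Eventually.of_forall fun s => ?_)
      simp
    rw [← integral_sub hi hi0, ← Real.norm_eq_abs, ← ENNReal.ofReal_le_ofReal_iff hpos, ofReal_norm]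
    exact (enorm_integral_le_lintegral_enorm _).trans h
  · have hi0 : ¬ Integrable (NN F0 t0) := by
      intro hi0
      apply hi
      have := hi0.add hD
      refine this.congr (Filter.Eventually.of_forall fun s => ?_)
      simp
    rw [integral_undef hi, integral_undef hi0]; simpa using hpos


lemma toSet_eq (Q : PCube n) : Q.toSet =
    ((WithLp.ofLp : Spc n → Fin n → ℝ) ⁻¹' (univ.pi fun i => Icc (Q.corner i) (Q.corner i + Q.len))) ×ˢ
      Icc Q.time (Q.time + Q.len ^ 2) := by
  ext p
  simp only [PCube.toSet, mem_prod, mem_preimage, mem_pi, mem_univ, true_imp_iff]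
  rfl

lemma measurableSet_toSet (Q : PCube n) : MeasurableSet Q.toSet := by
  rw [toSet_eq]
  refine MeasurableSet.prod ?_ measurableSet_Icc
  exact (PiLp.volume_preserving_ofLp (Fin n)).measurable (MeasurableSet.univ_pi fun i => measurableSet_Icc)

lemma volume_toSet (Q : PCube n) : volume Q.toSet = ENNReal.ofReal (Q.len ^ (n + 2)) := by
  have hl := Q.len_pos
  rw [toSet_eq, Measure.volume_eq_prod, Measure.prod_prod,
    (PiLp.volume_preserving_ofLp (Fin n)).measure_preimage (MeasurableSet.univ_pi fun i => measurableSet_Icc).nullMeasurableSet,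
    Real.volume_Icc, volume_pi_pi]
  simp only [Real.volume_Icc, add_sub_cancel_left, Finset.prod_const, Finset.card_univ, Fintype.card_fin]
  rw [← ENNReal.ofReal_pow hl.le, ← ENNReal.ofReal_mul (by positivity), pow_add]

lemma norm_sub_toSet (Q : PCube n) {x y : Spc n} {s t : ℝ} (hx : (x, s) ∈ Q.toSet) (hy : (y, t) ∈ Q.toSet) :
    ‖x - y‖ ≤ √n * Q.len := by
  have hl := Q.len_pos
  rw [EuclideanSpace.norm_eq, Real.sqrt_le_left (by positivity), mul_pow, Real.sq_sqrt (by positivity)]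
  calc _ ≤ ∑ _i : Fin n, Q.len ^ 2 := by
        apply Finset.sum_le_sum
        intro i _
        have h1 := hx.1 i
        have h2 := hy.1 i
        simp only [PiLp.sub_apply, Real.norm_eq_abs, sq_abs]
        apply sq_le_sq'
        · linarith [h1.1, h2.2]
        · linarith [h1.2, h2.1]
    _ = _ := by simp

lemma measurable_halfT (ν : SignedMeasure (Pt n)) : Measurable (halfT (convW ν)) := by
  have hm := measurable_convW ν
  have : StronglyMeasurable (fun z : Pt n × ℝ => (convW ν (z.1.1, z.2) - convW ν z.1) / |z.2 - z.1.2| ^ (3 / 2 : ℝ)) := by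
    apply Measurable.stronglyMeasurable
    fun_prop
  exact (this.integral_prod_right (ν := volume)).measurable

/-- the constant -/
def CF (n : ℕ) : ℝ := 2 * (16 * CH n + 8) + 4 * (2 * √n + 13)

lemma CF_nonneg : 0 ≤ CF n := by
  have := CH_nonneg (n := n)
  unfold CF; positivity

lemma halfT_diff (Q : PCube n) (ν : SignedMeasure (Pt n))
    (h4 : ν.totalVariation ((Q.dilate 4 (by norm_num)).toSet) = 0)
    (hν : ∀ p, ‖convGradW ν p‖ ≤ 1) (hL : LipHalfLe (convW ν) 1)
    {x x0 : Spc n} {t t0 : ℝ} (hp : (x, t) ∈ Q.toSet) (hp0 : (x0, t0) ∈ Q.toSet)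
    (hx : ∀ᵐ x' : Spc n, ∀ s : ℝ, |convW ν (x', s) - convW ν (x, s)| ≤ ‖x' - x‖)
    (hx0 : ∀ᵐ x' : Spc n, ∀ s : ℝ, |convW ν (x', s) - convW ν (x0, s)| ≤ ‖x' - x0‖)
    (hxx : ∀ s : ℝ, |convW ν (x, s) - convW ν (x0, s)| ≤ ‖x - x0‖)
    (hg : Good ν (x, t)) (hg0 : Good ν (x0, t0))
    (hs : ∀ᵐ s : ℝ, Good ν (x, s)) (hs0 : ∀ᵐ s : ℝ, Good ν (x0, s)) :
    |halfT (convW ν) (x, t) - halfT (convW ν) (x0, t0)| ≤ CF n := by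
  have hm := measurable_convW ν
  refine oneD_int (F := fun s => convW ν (x, s)) (F0 := fun s => convW ν (x0, s)) Q.len_pos
    CH_nonneg (Real.sqrt_nonneg n) ?_ ?_ ?_ ?_ ?_ ?_ ?_ ?_
  · have h1 := hp.2
    have h2 := hp0.2
    exact abs_le.mpr ⟨by linarith [h1.1, h2.2], by linarith [h1.2, h2.1]⟩
  · intro s u
    simpa using hL x s u
  · intro s u
    simpa using hL x0 s u
  · exact (cont_of_lip hL x).measurable
  · exact (cont_of_lip hL x0).measurable
  · intro s
    exact (hxx s).trans (norm_sub_toSet Q hp hp0)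
  · filter_upwards [hs] with s h h1 using near_holder Q ν h4 hν hL hp hx hg h h1
  · filter_upwards [hs0] with s h h1 using near_holder Q ν h4 hν hL hp0 hx0 hg0 h h1

lemma exists_base (Q : PCube n) (ν : SignedMeasure (Pt n))
    (h4 : ν.totalVariation ((Q.dilate 4 (by norm_num)).toSet) = 0)
    (hν : ∀ p, ‖convGradW ν p‖ ≤ 1) (hL : LipHalfLe (convW ν) 1) :
    ∃ k : ℝ, ∀ᵐ p ∂(volume.restrict Q.toSet), |halfT (convW ν) p - k| ≤ CF n := by
  have hl := Q.len_pos
  have a1 : ∀ᵐ p : Pt n, ∀ᵐ x' : Spc n, ∀ s : ℝ, |convW ν (x', s) - convW ν (p.1, s)| ≤ ‖x' - p.1‖ := by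
    rw [Measure.volume_eq_prod]
    exact Measure.quasiMeasurePreserving_fst.ae (conv_lip ν hν hL)
  have a2 : ∀ᵐ p : Pt n, Good ν p := ae_good ν
  have a3 : ∀ᵐ p : Pt n, ∀ᵐ s : ℝ, Good ν (p.1, s) := by
    rw [Measure.volume_eq_prod] at a2 ⊢
    exact Measure.quasiMeasurePreserving_fst.ae (Measure.ae_ae_of_ae_prod a2)
  have hne : (volume.restrict Q.toSet : Measure (Pt n)) ≠ 0 := by
    rw [Ne, Measure.restrict_eq_zero, volume_toSet, ENNReal.ofReal_eq_zero, not_le]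
    positivity
  have : NeZero (volume.restrict Q.toSet : Measure (Pt n)) := ⟨hne⟩
  have hall : ∀ᵐ p ∂(volume.restrict Q.toSet), p ∈ Q.toSet ∧
      (∀ᵐ x' : Spc n, ∀ s : ℝ, |convW ν (x', s) - convW ν (p.1, s)| ≤ ‖x' - p.1‖) ∧
      Good ν p ∧ ∀ᵐ s : ℝ, Good ν (p.1, s) := by
    filter_upwards [ae_restrict_mem (measurableSet_toSet Q), ae_restrict_of_ae a1, ae_restrict_of_ae a2,
      ae_restrict_of_ae a3] with p b1 b2 b3 b4 using ⟨b1, b2, b3, b4⟩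
  obtain ⟨⟨x0, t0⟩, c1, c2, c3, c4⟩ := hall.exists
  have a4 : ∀ᵐ p : Pt n, ∀ s : ℝ, |convW ν (p.1, s) - convW ν (x0, s)| ≤ ‖p.1 - x0‖ := by
    rw [Measure.volume_eq_prod]
    exact Measure.quasiMeasurePreserving_fst.ae c2
  refine ⟨halfT (convW ν) (x0, t0), ?_⟩
  filter_upwards [hall, ae_restrict_of_ae a4] with p hp h
  exact halfT_diff Q ν h4 hν hL hp.1 c1 hp.2.1 c2 h hp.2.2.1 c3 hp.2.2.2 c4

lemma osc_le (Q : PCube n) {g : Pt n → ℝ} (hg : Measurable g) {k C : ℝ}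
    (h : ∀ᵐ p ∂(volume.restrict Q.toSet), |g p - k| ≤ C) :
    ∫ p in Q.toSet, |g p - ⨍ q in Q.toSet, g q| ≤ 2 * C * Q.len ^ (n + 2) := by
  have hl := Q.len_pos
  have hV : (volume.restrict Q.toSet).real univ = Q.len ^ (n + 2) := by
    rw [Measure.real, Measure.restrict_apply_univ, volume_toSet, ENNReal.toReal_ofReal (by positivity)]
  have hVp : 0 < Q.len ^ (n + 2) := by positivity
  have : IsFiniteMeasure (volume.restrict Q.toSet : Measure (Pt n)) :=
    ⟨by rw [Measure.restrict_apply_univ, volume_toSet]; exact ENNReal.ofReal_lt_top⟩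
  have hi : Integrable (fun p => g p - k) (volume.restrict Q.toSet) :=
    Integrable.of_bound (hg.sub_const k).aestronglyMeasurable C h
  have hig : Integrable g (volume.restrict Q.toSet) := by
    refine (hi.add (integrable_const k)).congr (Filter.Eventually.of_forall fun s => ?_)
    simp
  have h1 : |∫ p in Q.toSet, (g p - k)| ≤ C * Q.len ^ (n + 2) := by
    rw [← hV, ← Real.norm_eq_abs]; exact norm_integral_le_of_norm_le_const (f := fun p => g p - k) h
  set m := ⨍ q in Q.toSet, g q with hm
  have hm' : Q.len ^ (n + 2) * m = ∫ q in Q.toSet, g q := by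
    rw [hm, average_eq, hV, smul_eq_mul]; field_simp
  have h2 : |m - k| ≤ C := by
    rw [integral_sub hig (integrable_const k), integral_const, hV, smul_eq_mul, ← hm', ← mul_sub, abs_mul,
      abs_of_pos hVp, mul_comm] at h1
    exact le_of_mul_le_mul_right h1 hVp
  have h3 : ‖∫ p in Q.toSet, |g p - m|‖ ≤ 2 * C * Q.len ^ (n + 2) := by
    rw [← hV]
    apply norm_integral_le_of_norm_le_const
    filter_upwards [h] with p hp
    rw [Real.norm_eq_abs, abs_abs]
    have : g p - m = (g p - k) - (m - k) := by ring
    rw [this]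
    refine (abs_sub _ _).trans ?_
    linarith
  exact (le_abs_self _).trans h3


end helpers

/-- Lemma 3.6: BMO oscillation estimate on `Q` for a measure supported
outside `4Q`, with parabolic growth, bounded `∇ₓ W * ν` and `W*ν` half-Lipschitz in time. -/
theorem bmo_far_measure (n : ℕ) (hn : 1 ≤ n) :
    ∃ C : ℝ, 0 < C ∧ ∀ (Q : PCube n) (ν : SignedMeasure (Pt n)),
      ν.totalVariation ((Q.dilate 4 (by norm_num)).toSet) = 0 →
      (∀ (R : PCube n) (φ : Pt n → ℝ), Admissible φ R → |sInt ν φ| ≤ R.len ^ (n + 1)) →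
      (∀ p, ‖convGradW ν p‖ ≤ 1) → LipHalfLe (convW ν) 1 →
      ∫ p in Q.toSet, |halfT (convW ν) p - ⨍ q in Q.toSet, halfT (convW ν) q| ≤
        C * Q.len ^ (n + 2) := by
  refine ⟨2 * CF n + 1, by have := CF_nonneg (n := n); positivity, ?_⟩
  intro Q ν h4 _ hν hL
  have hl := Q.len_pos
  obtain ⟨k, hk⟩ := exists_base Q ν h4 hν hL
  refine (osc_le Q (measurable_halfT ν) hk).trans ?_
  gcongr
  linarith
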